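/- Let T be a finitely generated module over an artin algebra A with I = Ann(T) and Ā = A/I. Then T is a τ-tilting A-module if and only if I is nilpotent, the Ā-module T is 1-tilting, and I ⊗_A T = 0. -/

import Mathlib

open TensorProduct

section BalancedTensor

variable (R A : Type) [CommRing R] [Ring A] [Algebra R A]

/-- The relations defining the balanced tensor product over `A` inside `X ⊗[R] T`. -/
def balRel (X T : Type) [AddCommGroup X] [Module Aᵐᵒᵖ X] [Module R X]
    [AddCommGroup T] [Module A T] [Module R T] : Submodule R (X ⊗[R] T) :=
  Submodule.span R {z | ∃ (x : X) (a : A) (t : T),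
    z = (MulOpposite.op a • x) ⊗ₜ[R] t - x ⊗ₜ[R] (a • t)}

/-- The balanced tensor product `X ⊗[A] T` of a right `A`-module `X` and a
left `A`-module `T`. -/
def balTensor (X T : Type) [AddCommGroup X] [Module Aᵐᵒᵖ X] [Module R X]
    [AddCommGroup T] [Module A T] [Module R T] : Type :=
  (X ⊗[R] T) ⧸ balRel R A X T

noncomputable instance (X T : Type) [AddCommGroup X] [Module Aᵐᵒᵖ X] [Module R X]
    [AddCommGroup T] [Module A T] [Module R T] : AddCommGroup (balTensor R A X T) :=
  inferInstanceAs (AddCommGroup ((X ⊗[R] T) ⧸ balRel R A X T))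

noncomputable instance (X T : Type) [AddCommGroup X] [Module Aᵐᵒᵖ X] [Module R X]
    [AddCommGroup T] [Module A T] [Module R T] : Module R (balTensor R A X T) :=
  inferInstanceAs (Module R ((X ⊗[R] T) ⧸ balRel R A X T))

/-- Functoriality of the balanced tensor product in the second variable. -/
noncomputable def balMap (X : Type) [AddCommGroup X] [Module Aᵐᵒᵖ X] [Module R X]
    {T T' : Type} [AddCommGroup T] [Module A T] [Module R T] [IsScalarTower R A T]
    [AddCommGroup T'] [Module A T'] [Module R T'] [IsScalarTower R A T']
    (f : T →ₗ[A] T') : balTensor R A X T →ₗ[R] balTensor R A X T' :=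
  Submodule.mapQ _ _ (TensorProduct.map LinearMap.id (f.restrictScalars R)) (by
    rw [← Submodule.map_le_iff_le_comap, balRel, Submodule.map_span]
    apply Submodule.span_le.2
    rintro z ⟨w, ⟨x, a, t, rfl⟩, rfl⟩
    apply Submodule.subset_span
    exact ⟨x, a, f t, by simp [TensorProduct.map_tmul, map_smul]⟩)

/-- The kernel of the canonical free presentation `(T →₀ A) → T`. -/
noncomputable def presKer (T : Type) [AddCommGroup T] [Module A T] : Submodule A (T →₀ A) :=
  LinearMap.ker (Finsupp.linearCombination A (id : T → T))

/-- `Tor₁^A(X, T)`, computed from the canonical free presentation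
`0 → K → (T →₀ A) → T → 0` of `T` as the kernel of `X ⊗[A] K → X ⊗[A] (T →₀ A)`. -/
noncomputable def Tor1 (X T : Type) [AddCommGroup X] [Module Aᵐᵒᵖ X] [Module R X]
    [AddCommGroup T] [Module A T] [Module R T] [IsScalarTower R A T] : Type :=
  ↥(LinearMap.ker (balMap R A X (T := ↥(presKer A T)) (T' := (T →₀ A))
      ((presKer A T).subtype)))

noncomputable instance (X T : Type) [AddCommGroup X] [Module Aᵐᵒᵖ X] [Module R X]
    [AddCommGroup T] [Module A T] [Module R T] [IsScalarTower R A T] :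
    AddCommGroup (Tor1 R A X T) :=
  inferInstanceAs (AddCommGroup ↥(LinearMap.ker (balMap R A X (T := ↥(presKer A T))
    (T' := (T →₀ A)) ((presKer A T).subtype))))

noncomputable instance (X T : Type) [AddCommGroup X] [Module Aᵐᵒᵖ X] [Module R X]
    [AddCommGroup T] [Module A T] [Module R T] [IsScalarTower R A T] :
    Module R (Tor1 R A X T) :=
  inferInstanceAs (Module R ↥(LinearMap.ker (balMap R A X (T := ↥(presKer A T))
    (T' := (T →₀ A)) ((presKer A T).subtype))))

/-- A two-sided ideal regarded as a right submodule of `A`. -/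
def rIdeal (I : TwoSidedIdeal A) : Submodule Aᵐᵒᵖ A where
  carrier := I
  add_mem' := I.add_mem
  zero_mem' := I.zero_mem
  smul_mem' := fun a x hx => by simpa using I.mul_mem_right x a.unop hx

instance : IsScalarTower R Aᵐᵒᵖ A :=
  ⟨fun r a x => by
    show x * (r • a).unop = r • (x * a.unop)
    simp [mul_smul_comm]⟩

end BalancedTensor

/-- The `n`-th Ext-group `Ext_A^n(M, N)` of left `A`-modules. -/
noncomputable def egrp (A : Type) [Ring A] (n : ℕ) (M N : Type) [AddCommGroup M] [Module A M]
    [AddCommGroup N] [Module A N] : Type :=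
  ((_root_.Ext ℤ (ModuleCat A) n).obj (Opposite.op (ModuleCat.of A M))).obj
    (ModuleCat.of A N)

noncomputable instance (A : Type) [Ring A] (n : ℕ) (M N : Type) [AddCommGroup M] [Module A M]
    [AddCommGroup N] [Module A N] : AddCommGroup (egrp A n M N) :=
  inferInstanceAs (AddCommGroup (((_root_.Ext ℤ (ModuleCat A) n).obj
    (Opposite.op (ModuleCat.of A M))).obj (ModuleCat.of A N)))

section Count

variable (B : Type) [Ring B]

/-- `M` is an indecomposable module. -/
def isIndec (M : Type) [AddCommGroup M] [Module B M] : Prop :=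
  Nontrivial M ∧ ∀ (X Y : Type) [AddCommGroup X] [Module B X] [AddCommGroup Y] [Module B Y],
    Nonempty (M ≃ₗ[B] X × Y) → Subsingleton X ∨ Subsingleton Y

/-- The setoid identifying isomorphic modules satisfying a given predicate. -/
def isoSetoid (pred : ModuleCat B → Prop) : Setoid {N : ModuleCat B // pred N} where
  r X Y := Nonempty (↥X.1 ≃ₗ[B] ↥Y.1)
  iseqv := ⟨fun _ => ⟨LinearEquiv.refl B _⟩, fun ⟨e⟩ => ⟨e.symm⟩, fun ⟨e⟩ ⟨f⟩ => ⟨e.trans f⟩⟩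

/-- `|M|`: the number of isomorphism classes of indecomposable direct summands of `M`. -/
noncomputable def numIndec (M : Type) [AddCommGroup M] [Module B M] : ℕ :=
  Nat.card (Quotient (isoSetoid B (fun N => isIndec B ↥N ∧
    ∃ (s : ↥N →ₗ[B] M) (r : M →ₗ[B] ↥N), r.comp s = LinearMap.id)))

end Count

section Fac

variable (A : Type) [Ring A]

/-- `fac(T)`: the class of factor modules of finite direct sums of copies of `T`. -/
def facP (T : Type) [AddCommGroup T] [Module A T]
    (M : Type) [AddCommGroup M] [Module A M] : Prop :=
  ∃ (n : ℕ) (f : (Fin n → T) →ₗ[A] M), Function.Surjective f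

/-- `M` is a direct summand of `N`. -/
def isSummand (M N : Type) [AddCommGroup M] [Module A M] [AddCommGroup N] [Module A N] :
    Prop :=
  ∃ (s : M →ₗ[A] N) (r : N →ₗ[A] M), r.comp s = LinearMap.id

/-- `add(T)`: direct summands of finite direct sums of copies of `T`. -/
def addP (T : Type) [AddCommGroup T] [Module A T]
    (M : Type) [AddCommGroup M] [Module A M] : Prop :=
  ∃ n : ℕ, isSummand A M (Fin n → T)

/-- The module `T` has projective dimension at most one. -/
def pdLeOne (T : Type) [AddCommGroup T] [Module A T] : Prop :=
  ∃ (P₀ P₁ : ModuleCat.{0} A) (_ : Module.Projective A ↥P₀) (_ : Module.Projective A ↥P₁)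
    (i : ↥P₁ →ₗ[A] ↥P₀) (p : ↥P₀ →ₗ[A] T),
      Function.Injective i ∧ Function.Surjective p ∧ Function.Exact i p

/-- `M` is a projective object of the exact category `fac(T)`. -/
def projInFac (T : Type) [AddCommGroup T] [Module A T]
    (M : Type) [AddCommGroup M] [Module A M] : Prop :=
  facP A T M ∧ ∀ (X Y Z : Type) [AddCommGroup X] [Module A X] [AddCommGroup Y] [Module A Y]
    [AddCommGroup Z] [Module A Z] (i : X →ₗ[A] Y) (p : Y →ₗ[A] Z),
      Function.Injective i → Function.Surjective p → Function.Exact i p →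
      facP A T X → facP A T Y → facP A T Z →
      ∀ g : M →ₗ[A] Z, ∃ h : M →ₗ[A] Y, p.comp h = g

end Fac

/-- `T` is `τ`-rigid, via the Auslander–Smalø criterion `Ext¹_A(T, fac(T)) = 0`. -/
def tauRigid (A : Type) [Ring A] (T : Type) [AddCommGroup T] [Module A T] : Prop :=
  ∀ (M : Type) [AddCommGroup M] [Module A M], facP A T M → Subsingleton (egrp A 1 T M)

/-- Powers of a (left) ideal in a possibly noncommutative ring. -/
def idealPow (A : Type) [Ring A] (I : Ideal A) : ℕ → Ideal A
  | 0 => ⊤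
  | (n + 1) => Submodule.span A {x : A | ∃ a ∈ I, ∃ b ∈ idealPow A I n, x = a * b}

set_option linter.style.haveILetI false


section SplSec

/-- every extension of `T` by `M` splits -/
def Spl (Λ : Type) [Ring Λ] (T M : Type) [AddCommGroup T] [Module Λ T] [AddCommGroup M]
    [Module Λ M] : Prop :=
  ∀ (E : Type) [AddCommGroup E] [Module Λ E] (i : M →ₗ[Λ] E) (q : E →ₗ[Λ] T),
    Function.Injective i → Function.Surjective q → Function.Exact i q →
    ∃ s : T →ₗ[Λ] E, q ∘ₗ s = LinearMap.id

/-- every map from the kernel of `p` to `M` extends -/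
def ExtP {Λ : Type} [Ring Λ] {P T : Type} (M : Type) [AddCommGroup P] [Module Λ P]
    [AddCommGroup T] [Module Λ T] [AddCommGroup M]
    [Module Λ M] (p : P →ₗ[Λ] T) : Prop :=
  ∀ k : LinearMap.ker p →ₗ[Λ] M, ∃ g : P →ₗ[Λ] M, g ∘ₗ (LinearMap.ker p).subtype = k

variable {Λ : Type} [Ring Λ] {P T M : Type} [AddCommGroup P] [Module Λ P]
    [AddCommGroup T] [Module Λ T] [AddCommGroup M] [Module Λ M]

/-- factor through an injective map -/
lemma exists_factor_inj {X E M : Type} [AddCommGroup X] [Module Λ X] [AddCommGroup E] [Module Λ E]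
    [AddCommGroup M] [Module Λ M]
    (i : M →ₗ[Λ] E) (hi : Function.Injective i) (d : X →ₗ[Λ] E)
    (hd : ∀ x, d x ∈ LinearMap.range i) : ∃ g : X →ₗ[Λ] M, i ∘ₗ g = d := by
  refine ⟨(LinearEquiv.ofInjective i hi).symm.toLinearMap ∘ₗ d.codRestrict _ hd, ?_⟩
  ext x
  have := (LinearEquiv.ofInjective i hi).apply_symm_apply ⟨d x, hd x⟩
  have := congrArg Subtype.val this
  simpa using this

/-- factor through a surjective map -/
lemma exists_factor_surj {X E M : Type} [AddCommGroup X] [Module Λ X] [AddCommGroup E] [Module Λ E]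
    [AddCommGroup M] [Module Λ M]
    (q : E →ₗ[Λ] X) (hq : Function.Surjective q) (d : E →ₗ[Λ] M)
    (hd : ∀ x, q x = 0 → d x = 0) : ∃ g : X →ₗ[Λ] M, g ∘ₗ q = d := by
  refine ⟨(LinearMap.ker q).liftQ d (fun x hx => hd x hx) ∘ₗ
    (q.quotKerEquivOfSurjective hq).symm.toLinearMap, ?_⟩
  ext x
  have : (q.quotKerEquivOfSurjective hq).symm (q x) = (LinearMap.ker q).mkQ x := by
    rw [LinearEquiv.symm_apply_eq]; simp
  simp only [LinearMap.comp_apply, LinearEquiv.coe_coe, this]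
  exact Submodule.liftQ_apply _ _ _

lemma Spl.extP (h : Spl Λ T M) (p : P →ₗ[Λ] T) (hp : Function.Surjective p) : ExtP M p := by
  intro k
  let W : Submodule Λ (M × P) := LinearMap.range (k.prod (-(LinearMap.ker p).subtype))
  let i : M →ₗ[Λ] (M × P) ⧸ W := W.mkQ ∘ₗ LinearMap.inl Λ M P
  let q : ((M × P) ⧸ W) →ₗ[Λ] T := W.liftQ (p ∘ₗ LinearMap.snd Λ M P) (by
    rintro _ ⟨x, rfl⟩
    simp)
  have hi : Function.Injective i := by
    rw [← LinearMap.ker_eq_bot, LinearMap.ker_eq_bot']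
    intro m hm
    have : (m, (0 : P)) ∈ W := by
      simpa [i, Submodule.Quotient.mk_eq_zero] using hm
    obtain ⟨x, hx⟩ := this
    have h2 : x = 0 := by
      have := congrArg Prod.snd hx
      simpa using this
    have h1 := congrArg Prod.fst hx
    simpa [h2] using h1.symm
  have hq : Function.Surjective q := by
    intro t
    obtain ⟨x, rfl⟩ := hp t
    exact ⟨W.mkQ (0, x), by simp [q]⟩
  have hex : Function.Exact i q := by
    intro y
    obtain ⟨⟨m, x⟩, rfl⟩ := W.mkQ_surjective y
    constructor
    · intro hy
      have hx : p x = 0 := by simpa [q] using hy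
      refine ⟨m + k ⟨x, hx⟩, ?_⟩
      simp only [i, LinearMap.comp_apply, LinearMap.inl_apply]
      rw [← sub_eq_zero, ← map_sub, Submodule.mkQ_apply, Submodule.Quotient.mk_eq_zero]
      exact ⟨⟨x, hx⟩, by simp⟩
    · rintro ⟨m', hm'⟩
      rw [← hm']
      simp [i, q]
  obtain ⟨s, hs⟩ := h _ i q hi hq hex
  obtain ⟨g, hg⟩ := exists_factor_inj i hi (W.mkQ ∘ₗ LinearMap.inr Λ M P - s ∘ₗ p) (by
    intro x
    apply (hex _).1
    have := LinearMap.congr_fun hs (p x)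
    simp only [LinearMap.comp_apply, LinearMap.id_apply] at this
    rw [LinearMap.sub_apply, map_sub, LinearMap.comp_apply, LinearMap.comp_apply, this]
    simp [q])
  refine ⟨g, ?_⟩
  ext x
  apply hi
  have := LinearMap.congr_fun hg x.1
  simp only [LinearMap.comp_apply, LinearMap.sub_apply, LinearMap.mem_ker.1 x.2, map_zero,
    sub_zero] at this
  simp only [LinearMap.comp_apply, Submodule.subtype_apply]
  rw [this]
  simp only [i, LinearMap.comp_apply]
  rw [eq_comm, ← sub_eq_zero, ← map_sub, Submodule.mkQ_apply, Submodule.Quotient.mk_eq_zero]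
  exact ⟨x, by simp⟩

lemma ExtP.spl [Module.Projective Λ P] (p : P →ₗ[Λ] T) (hp : Function.Surjective p)
    (h : ExtP M p) : Spl Λ T M := by
  intro E _ _ i q hi hq hex
  obtain ⟨u, hu⟩ := Module.projective_lifting_property q p hq
  obtain ⟨k, hk⟩ := exists_factor_inj i hi (u ∘ₗ (LinearMap.ker p).subtype) (by
    intro x
    apply (hex _).1
    have := LinearMap.congr_fun hu x.1
    simp only [LinearMap.comp_apply] at this
    simp [this])
  obtain ⟨g, hg⟩ := h k
  obtain ⟨s, hs⟩ := exists_factor_surj p hp (u - i ∘ₗ g) (by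
    intro x hx
    have h1 := LinearMap.congr_fun hg ⟨x, hx⟩
    have h2 := LinearMap.congr_fun hk ⟨x, hx⟩
    simp only [LinearMap.comp_apply, Submodule.subtype_apply] at h1 h2
    simp [h1, h2])
  refine ⟨s, ?_⟩
  ext t
  obtain ⟨x, rfl⟩ := hp t
  have h1 := LinearMap.congr_fun hs x
  have h2 := LinearMap.congr_fun hu x
  simp only [LinearMap.comp_apply, LinearMap.sub_apply] at h1 h2
  simp only [LinearMap.comp_apply, LinearMap.id_apply]
  rw [h1, map_sub, h2, hex.apply_apply_eq_zero, sub_zero]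

open CategoryTheory in
lemma egrp_iff (T M : Type) [AddCommGroup T] [Module Λ T] [AddCommGroup M] [Module Λ M] :
    Subsingleton (egrp Λ 1 T M) ↔ Spl Λ T M := by
  let R := projectiveResolution (ModuleCat.of Λ T)
  have e := (R.isoExt (R := ℤ) 1 (ModuleCat.of Λ M))
  have h1 : Subsingleton (egrp Λ 1 T M) ↔
      ∀ f : R.complex.X 1 ⟶ ModuleCat.of Λ M, R.complex.d 2 1 ≫ f = 0 →
        ∃ g : R.complex.X 0 ⟶ ModuleCat.of Λ M, R.complex.d 1 0 ≫ g = f := by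
    unfold egrp
    rw [← ModuleCat.isZero_iff_subsingleton, e.isZero_iff,
      ← HomologicalComplex.exactAt_iff_isZero_homology,
      HomologicalComplex.exactAt_iff' _ 0 1 2 (by simp) (by simp),
      ShortComplex.moduleCat_exact_iff]
    constructor
    · intro h f hf
      obtain ⟨g, hg⟩ := h f hf
      exact ⟨g, hg⟩
    · intro h f hf
      obtain ⟨g, hg⟩ := h f hf
      exact ⟨g, hg⟩
  have hp0 : Module.Projective Λ (R.complex.X 0) :=
    (IsProjective.iff_projective (R.complex.X 0)).2 (R.projective 0)
  let p : R.complex.X 0 →ₗ[Λ] T := (R.π.f 0).hom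
  have hp : Function.Surjective p := (ModuleCat.epi_iff_surjective (R.π.f 0)).1 inferInstance
  have hpd : ∀ x, p ((R.complex.d 1 0).hom x) = 0 := fun x => by
    have := R.complex_d_comp_π_f_zero
    exact congrArg (fun f => f.hom x) this
  have ex0 : ∀ y, p y = 0 → ∃ x, (R.complex.d 1 0).hom x = y :=
    (ShortComplex.moduleCat_exact_iff _).1 R.exact₀
  have ex1 : ∀ y, (R.complex.d 1 0).hom y = 0 → ∃ x, (R.complex.d 2 1).hom x = y :=
    (ShortComplex.moduleCat_exact_iff _).1 (R.exact_succ 0)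
  let d1 : R.complex.X 1 →ₗ[Λ] LinearMap.ker p := (R.complex.d 1 0).hom.codRestrict _ hpd
  have hd1 : Function.Surjective d1 := by
    rintro ⟨y, hy⟩
    obtain ⟨x, hx⟩ := ex0 y hy
    exact ⟨x, Subtype.ext hx⟩
  rw [h1]
  constructor
  · intro h
    apply ExtP.spl p hp
    intro k
    obtain ⟨g, hg⟩ := h (ModuleCat.ofHom (k ∘ₗ d1)) (by
      ext x
      have h0 : (R.complex.d 1 0).hom ((R.complex.d 2 1).hom x) = 0 := by
        have := R.complex.d_comp_d 2 1 0
        exact congrArg (fun f => f.hom x) this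
      have : d1 ((R.complex.d 2 1).hom x) = 0 := Subtype.ext h0
      change k (d1 ((R.complex.d 2 1).hom x)) = 0
      rw [this, map_zero])
    refine ⟨g.hom, ?_⟩
    apply LinearMap.ext
    intro x
    obtain ⟨y, rfl⟩ := hd1 x
    exact congrArg (fun f => f.hom y) hg
  · intro h f hf
    obtain ⟨k, hk⟩ := exists_factor_surj d1 hd1 f.hom (by
      intro x hx
      obtain ⟨y, rfl⟩ := ex1 x (congrArg Subtype.val hx)
      exact congrArg (fun f => f.hom y) hf)
    obtain ⟨g, hg⟩ := h.extP p hp k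
    refine ⟨ModuleCat.ofHom g, ?_⟩
    ext x
    have := LinearMap.congr_fun hg (d1 x)
    have h2 := LinearMap.congr_fun hk x
    exact this.trans h2
end SplSec


section IndecSec
variable {Λ : Type} [Ring Λ]

lemma isIndec.of_isCompl {M : Type} [AddCommGroup M] [Module Λ M] (h : isIndec Λ M)
    {X Y : Submodule Λ M} (hc : IsCompl X Y) : X = ⊥ ∨ Y = ⊥ := by
  rcases h.2 X Y ⟨(Submodule.prodEquivOfIsCompl X Y hc).symm⟩ with h | h
  · left; exact (Submodule.subsingleton_iff_eq_bot).1 h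
  · right; exact (Submodule.subsingleton_iff_eq_bot).1 h

lemma fitting {M : Type} [AddCommGroup M] [Module Λ M] (hM : IsFiniteLength Λ M)
    (h : isIndec Λ M) (f : M →ₗ[Λ] M) : (∃ n, f ^ n = 0) ∨ Function.Bijective f := by
  obtain ⟨h1, h2⟩ := isFiniteLength_iff_isNoetherian_isArtinian.1 hM
  obtain ⟨n, hn⟩ := Filter.eventually_atTop.1 (LinearMap.eventually_isCompl_ker_pow_range_pow f)
  have hc := hn (n + 1) (by omega)
  rcases h.of_isCompl hc with h | h
  · right
    apply IsArtinian.bijective_of_injective_endomorphism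
    rw [← LinearMap.ker_eq_bot, eq_bot_iff, ← h]
    intro x hx
    have : f x = 0 := hx
    simp [pow_succ, this]
  · left
    exact ⟨n + 1, LinearMap.range_eq_bot.1 h⟩

lemma bij_one_sub {M : Type} [AddCommGroup M] [Module Λ M] (f : M →ₗ[Λ] M)
    (h : ∃ n, f ^ n = 0) : Function.Bijective (LinearMap.id - f : M →ₗ[Λ] M) := by
  have h1 : IsNilpotent (f : Module.End Λ M) := h
  have : IsUnit ((1 : Module.End Λ M) - f) := h1.isUnit_one_sub
  exact (Module.End.isUnit_iff _).1 this

lemma nonbij_add {M : Type} [AddCommGroup M] [Module Λ M] (hM : IsFiniteLength Λ M)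
    (h : isIndec Λ M) (f g : M →ₗ[Λ] M) (hf : ¬ Function.Bijective f)
    (hg : ¬ Function.Bijective g) : ¬ Function.Bijective (f + g : M →ₗ[Λ] M) := by
  intro hb
  let e := LinearEquiv.ofBijective _ hb
  have he : ∀ x, e x = f x + g x := fun x => rfl
  have h1 : ¬ Function.Bijective (e.symm.toLinearMap ∘ₗ f) := by
    intro hb
    apply hf
    have := e.bijective.comp hb
    convert this using 1
    ext x; simp
  have h2 := (fitting hM h (e.symm.toLinearMap ∘ₗ f)).resolve_right h1
  have h3 := e.bijective.comp (bij_one_sub _ h2)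
  apply hg
  convert h3 using 1
  ext x
  rw [Function.comp_apply, LinearMap.sub_apply, map_sub, LinearMap.comp_apply,
    LinearEquiv.coe_coe, e.apply_symm_apply, LinearMap.id_apply, he, add_sub_cancel_left]

lemma nonbij_sum {M : Type} [AddCommGroup M] [Module Λ M] (hM : IsFiniteLength Λ M)
    (h : isIndec Λ M) {ι : Type} (s : Finset ι) (f : ι → (M →ₗ[Λ] M))
    (hf : ∀ i ∈ s, ¬ Function.Bijective (f i)) : ¬ Function.Bijective (∑ i ∈ s, f i : M →ₗ[Λ] M) := by
  classical
  induction s using Finset.induction_on with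
  | empty =>
    intro hb
    have := h.1
    obtain ⟨x, y, hxy⟩ := exists_pair_ne M
    exact hxy (hb.1 (by simp))
  | insert a s ha ih =>
    rw [Finset.sum_insert ha]
    exact nonbij_add hM h _ _ (hf a (by simp)) (ih fun i hi => hf i (by simp [hi]))

lemma bij_of_comp {X Y : Type} [AddCommGroup X] [Module Λ X] [AddCommGroup Y] [Module Λ Y]
    (hX : isIndec Λ X) (hY : isIndec Λ Y) (s : X →ₗ[Λ] Y) (f : Y →ₗ[Λ] X)
    (h : Function.Bijective (f ∘ₗ s)) : Function.Bijective f := by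
  have hc : IsCompl (LinearMap.range s) (LinearMap.ker f) := by
    constructor
    · rw [Submodule.disjoint_def]
      rintro _ ⟨x, rfl⟩ hx
      have : x = 0 := h.1 (by simpa using hx)
      simp [this]
    · rw [codisjoint_iff, eq_top_iff]
      intro y _
      obtain ⟨x, hx⟩ := h.2 (f y)
      rw [Submodule.mem_sup]
      exact ⟨s x, ⟨x, rfl⟩, y - s x, by simp only [LinearMap.comp_apply] at hx; simp [hx], by simp⟩
  refine ⟨?_, fun x => ?_⟩
  · rcases hY.of_isCompl hc with h1 | h1
    · exfalso
      have := hX.1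
      obtain ⟨x, y, hxy⟩ := exists_pair_ne X
      rw [LinearMap.range_eq_bot] at h1
      exact hxy (h.1 (by simp [h1]))
    · exact LinearMap.ker_eq_bot.1 h1
  · obtain ⟨y, hy⟩ := h.2 x
    exact ⟨s y, hy⟩

lemma quot_inj {α β : Type 1} (sα : Setoid α) (sβ : Setoid β) (r : α → β → Prop)
    (h1 : ∀ a, ∃ b, r a b)
    (h3 : ∀ a b a' b', r a b → r a' b' → (sα a a' ↔ sβ b b')) :
    ∃ F : Quotient sα → Quotient sβ, Function.Injective F ∧
      ∀ a b, r a b → F (Quotient.mk sα a) = Quotient.mk sβ b := by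
  choose g hg using h1
  refine ⟨Quotient.map' (s₁ := sα) (s₂ := sβ) g
    fun a a' h => (h3 a _ a' _ (hg a) (hg a')).1 h, ?_, ?_⟩
  · intro x y
    induction x using Quotient.inductionOn
    induction y using Quotient.inductionOn
    intro h
    exact Quotient.sound ((h3 _ _ _ _ (hg _) (hg _)).2 (Quotient.exact h))
  · intro a b hab
    exact Quotient.sound ((h3 _ _ _ _ (hg a) hab).1 (sα.refl a))

lemma card_quot_eq {α β : Type 1} (sα : Setoid α) (sβ : Setoid β) (r : α → β → Prop)
    (h1 : ∀ a, ∃ b, r a b) (h2 : ∀ b, ∃ a, r a b)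
    (h3 : ∀ a b a' b', r a b → r a' b' → (sα a a' ↔ sβ b b')) :
    Nat.card (Quotient sα) = Nat.card (Quotient sβ) := by
  obtain ⟨F, hF, hr⟩ := quot_inj sα sβ r h1 h3
  apply Nat.card_eq_of_bijective F ⟨hF, ?_⟩
  intro y
  induction y using Quotient.inductionOn with
  | _ b =>
  obtain ⟨a, ha⟩ := h2 b
  exact ⟨_, hr a b ha⟩

variable (Λ) in
/-- isomorphism classes of simple modules -/
def simSet : Type 1 := Quotient (isoSetoid Λ (fun N => IsSimpleModule Λ ↥N))

/-- class of a simple module -/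
def simCls (S : Type) [AddCommGroup S] [Module Λ S] (h : IsSimpleModule Λ S) : simSet Λ :=
  Quotient.mk (isoSetoid Λ (fun N => IsSimpleModule Λ ↥N)) ⟨ModuleCat.of Λ S, h⟩

lemma simCls_eq {S S' : Type} [AddCommGroup S] [Module Λ S] (h : IsSimpleModule Λ S)
    [AddCommGroup S'] [Module Λ S'] (h' : IsSimpleModule Λ S') (e : S ≃ₗ[Λ] S') :
    simCls S h = simCls S' h' := Quotient.sound ⟨e⟩

lemma simSet_cases (x : simSet Λ) : ∃ (S : ModuleCat.{0} Λ) (h : IsSimpleModule Λ S),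
    x = simCls S h := by
  induction x using Quotient.inductionOn with
  | _ b => exact ⟨b.1, b.2, rfl⟩

/-- iso from simple quotients -/
noncomputable def quotIso {P S S' : Type} [AddCommGroup P] [Module Λ P] [AddCommGroup S] [Module Λ S]
    [AddCommGroup S'] [Module Λ S'] (f : P →ₗ[Λ] S) (f' : P →ₗ[Λ] S')
    (hf : Function.Surjective f) (hf' : Function.Surjective f')
    (h : LinearMap.ker f = LinearMap.ker f') : S ≃ₗ[Λ] S' :=
  (f.quotKerEquivOfSurjective hf).symm.trans
    ((Submodule.quotEquivOfEq _ _ h).trans (f'.quotKerEquivOfSurjective hf'))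

lemma ker_coatom {P S : Type} [AddCommGroup P] [Module Λ P] [AddCommGroup S] [Module Λ S]
    (h : IsSimpleModule Λ S) (f : P →ₗ[Λ] S) (hf : Function.Surjective f) :
    IsCoatom (LinearMap.ker f) := by
  rw [← isSimpleModule_iff_isCoatom]
  exact IsSimpleModule.congr (f.quotKerEquivOfSurjective hf)

lemma fin_simple_quot {M : Type} [AddCommGroup M] [Module Λ M] (hM : IsFiniteLength Λ M) :
    ∃ s : Set (simSet Λ), s.Finite ∧ ∀ (S : ModuleCat.{0} Λ) (h : IsSimpleModule Λ S),
      (∃ f : M →ₗ[Λ] S, Function.Surjective f) → simCls S h ∈ s := by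
  induction hM with
  | of_subsingleton =>
    refine ⟨∅, Set.finite_empty, ?_⟩
    rintro S h ⟨f, hf⟩
    have := hf.subsingleton
    have := IsSimpleModule.nontrivial Λ S
    exact (not_subsingleton S inferInstance).elim
  | @of_simple_quotient M _ _ N hN _ ih =>
    obtain ⟨s, hs, hs'⟩ := ih
    refine ⟨insert (simCls (M ⧸ N) hN) s, hs.insert _, ?_⟩
    rintro S h ⟨f, hf⟩
    by_cases hz : f ∘ₗ N.subtype = 0
    · left
      refine simCls_eq _ _ (quotIso f N.mkQ hf N.mkQ_surjective ?_)
      have h1 : N ≤ LinearMap.ker f := fun x hx => LinearMap.congr_fun hz ⟨x, hx⟩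
      have h2 : IsCoatom N := isSimpleModule_iff_isCoatom.1 hN
      rw [Submodule.ker_mkQ]
      rcases h2.le_iff.1 h1 with h3 | h3
      · exact absurd h3 (ker_coatom h f hf).1
      · exact h3
    · right
      exact hs' S h ⟨_, LinearMap.surjective_of_ne_zero hz⟩

lemma finite_simSet (h : IsFiniteLength Λ Λ) : Finite (simSet Λ) := by
  obtain ⟨s, hs, hs'⟩ := fin_simple_quot h
  have : s = Set.univ := by
    ext x
    simp only [Set.mem_univ, iff_true]
    obtain ⟨S, hS, rfl⟩ := simSet_cases x
    apply hs'
    have := IsSimpleModule.nontrivial Λ S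
    obtain ⟨x, hx⟩ := exists_ne (0 : S)
    exact ⟨LinearMap.toSpanSingleton Λ S x, IsSimpleModule.toSpanSingleton_surjective Λ hx⟩
  rw [this] at hs
  exact Set.finite_univ_iff.1 hs

lemma exists_indec_summand {S : Type} [AddCommGroup S] [Module Λ S] (n : ℕ) :
    ∀ (N : Type) [AddCommGroup N] [Module Λ N] (_ : Module.length Λ N = n)
    (f : N →ₗ[Λ] S) (_ : f ≠ 0), ∃ (P : ModuleCat.{0} Λ) (s : P →ₗ[Λ] N) (r : N →ₗ[Λ] P),
      isIndec Λ P ∧ r ∘ₗ s = LinearMap.id ∧ f ∘ₗ s ≠ 0 := by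
  induction n using Nat.strong_induction_on with
  | _ n ih =>
  intro N _ _ hn f hf
  by_cases hi : isIndec Λ N
  · exact ⟨ModuleCat.of Λ N, LinearMap.id, LinearMap.id, hi, rfl, hf⟩
  · have hnt : Nontrivial N := by
      by_contra h
      rw [not_nontrivial_iff_subsingleton] at h
      apply hf
      ext x
      rw [Subsingleton.elim x 0, map_zero, map_zero]
    simp only [isIndec, hnt, true_and] at hi
    push Not at hi
    obtain ⟨X, Y, _, _, _, _, ⟨e⟩, hX, hY⟩ := hi
    have hl : Module.length Λ X + Module.length Λ Y = n := by
      rw [← Module.length_prod, ← e.length_eq, hn]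
    have hXp := Module.length_pos (R := Λ) (M := X)
    have hYp := Module.length_pos (R := Λ) (M := Y)
    obtain ⟨a, ha⟩ := ENat.ne_top_iff_exists.1 (show Module.length Λ X ≠ ⊤ by
      intro h; rw [h] at hl; simp at hl)
    obtain ⟨b, hb⟩ := ENat.ne_top_iff_exists.1 (show Module.length Λ Y ≠ ⊤ by
      intro h; rw [h] at hl; simp at hl)
    rw [← ha] at hl hXp
    rw [← hb] at hl hYp
    norm_cast at hl hXp hYp
    by_cases h1 : f ∘ₗ e.symm.toLinearMap ∘ₗ LinearMap.inl Λ X Y = 0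
    · by_cases h2 : f ∘ₗ e.symm.toLinearMap ∘ₗ LinearMap.inr Λ X Y = 0
      · exfalso
        apply hf
        have : f ∘ₗ e.symm.toLinearMap = 0 := LinearMap.prod_ext h1 h2
        ext x
        simpa using LinearMap.congr_fun this (e x)
      · obtain ⟨P, s, r, hP, hrs, hs⟩ := ih b (by omega) Y hb.symm _ h2
        refine ⟨P, e.symm.toLinearMap ∘ₗ LinearMap.inr Λ X Y ∘ₗ s,
          r ∘ₗ LinearMap.snd Λ X Y ∘ₗ e.toLinearMap, hP, ?_, hs⟩
        ext x
        simpa using LinearMap.congr_fun hrs x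
    · obtain ⟨P, s, r, hP, hrs, hs⟩ := ih a (by omega) X ha.symm _ h1
      refine ⟨P, e.symm.toLinearMap ∘ₗ LinearMap.inl Λ X Y ∘ₗ s,
          r ∘ₗ LinearMap.fst Λ X Y ∘ₗ e.toLinearMap, hP, ?_, hs⟩
      ext x
      simpa using LinearMap.congr_fun hrs x

lemma indec_proj_top {P S S' : Type} [AddCommGroup P] [Module Λ P] [AddCommGroup S] [Module Λ S]
    [AddCommGroup S'] [Module Λ S'] [Module.Projective Λ P] (hP : IsFiniteLength Λ P)
    (hi : isIndec Λ P) (hS : IsSimpleModule Λ S) (hS' : IsSimpleModule Λ S')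
    (f : P →ₗ[Λ] S) (f' : P →ₗ[Λ] S')
    (hf : Function.Surjective f) (hf' : Function.Surjective f') : Nonempty (S ≃ₗ[Λ] S') := by
  by_cases hk : LinearMap.ker f = LinearMap.ker f'
  · exact ⟨quotIso f f' hf hf' hk⟩
  exfalso
  have hc := ker_coatom hS f hf
  have hc' := ker_coatom hS' f' hf'
  have hnz : f' ∘ₗ (LinearMap.ker f).subtype ≠ 0 := by
    intro h0
    have h1 : LinearMap.ker f ≤ LinearMap.ker f' := fun x hx => LinearMap.congr_fun h0 ⟨x, hx⟩
    rcases hc.le_iff.1 h1 with h3 | h3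
    · exact hc'.1 h3
    · exact hk h3.symm
  obtain ⟨h, hh⟩ := Module.projective_lifting_property _ f' (LinearMap.surjective_of_ne_zero hnz)
  rcases fitting hP hi ((LinearMap.ker f).subtype ∘ₗ h) with hn | hb
  · have := (bij_one_sub _ hn).2
    apply hc'.1
    rw [eq_top_iff]
    intro x _
    obtain ⟨y, rfl⟩ := this x
    have := LinearMap.congr_fun hh y
    simp only [LinearMap.comp_apply] at this
    simp [sub_eq_zero] at this ⊢
    exact this.symm
  · apply hc.1
    rw [eq_top_iff]
    intro x _
    obtain ⟨y, rfl⟩ := hb.2 x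
    exact (h y).2

lemma indec_proj_iso {P Q S : Type} [AddCommGroup P] [Module Λ P] [AddCommGroup Q] [Module Λ Q]
    [AddCommGroup S] [Module Λ S] [Module.Projective Λ P] [Module.Projective Λ Q]
    (hP : IsFiniteLength Λ P) (hQ : IsFiniteLength Λ Q)
    (hi : isIndec Λ P) (hj : isIndec Λ Q) [Nontrivial S]
    (f : P →ₗ[Λ] S) (g : Q →ₗ[Λ] S)
    (hf : Function.Surjective f) (hg : Function.Surjective g) : Nonempty (P ≃ₗ[Λ] Q) := by
  obtain ⟨u, hu⟩ := Module.projective_lifting_property g f hg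
  obtain ⟨v, hv⟩ := Module.projective_lifting_property f g hf
  have key : ∀ n, f ∘ₗ ((v ∘ₗ u) ^ n) = f := by
    intro n
    induction n with
    | zero => rfl
    | succ n ih =>
      rw [pow_succ]
      ext x
      have h1 := LinearMap.congr_fun ih (v (u x))
      have h2 := LinearMap.congr_fun hv (u x)
      have h3 := LinearMap.congr_fun hu x
      simp only [LinearMap.comp_apply] at h1 h2 h3
      simp only [LinearMap.comp_apply, Module.End.mul_apply]
      rw [h1, h2, h3]
  have hvu : Function.Bijective (v ∘ₗ u) := by
    refine (fitting hP hi (v ∘ₗ u)).resolve_left ?_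
    rintro ⟨n, hn⟩
    have := key n
    rw [hn] at this
    obtain ⟨x, hx⟩ := exists_ne (0 : S)
    obtain ⟨y, rfl⟩ := hf x
    apply hx
    rw [← this]; simp
  exact ⟨(LinearEquiv.ofBijective v (bij_of_comp hi hj u v hvu)).symm⟩

lemma numIndec_self (hL : IsFiniteLength Λ Λ) : numIndec Λ Λ = Nat.card (simSet Λ) := by
  have hfin : ∀ (P : ModuleCat.{0} Λ), (∃ (s : ↥P →ₗ[Λ] Λ) (r : Λ →ₗ[Λ] ↥P), r.comp s = LinearMap.id) →
      Module.Projective Λ P ∧ Module.Finite Λ P ∧ IsFiniteLength Λ P := by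
    rintro P ⟨s, r, h⟩
    have hr : Function.Surjective r := fun x => ⟨s x, LinearMap.congr_fun h x⟩
    exact ⟨Module.Projective.of_split s r h, Module.Finite.of_surjective r hr,
      hL.of_surjective hr⟩
  refine card_quot_eq _ _ (fun P S => ∃ f : P.1 →ₗ[Λ] S.1, Function.Surjective f) ?_ ?_ ?_
  · rintro ⟨P, hi, hs⟩
    obtain ⟨-, h2, -⟩ := hfin P hs
    have := hi.1
    obtain ⟨m, hm⟩ := (IsCoatomic.eq_top_or_exists_le_coatom (⊥ : Submodule Λ P)).resolve_left
      bot_ne_top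
    exact ⟨⟨ModuleCat.of Λ (P ⧸ m), isSimpleModule_iff_isCoatom.2 hm.1⟩, m.mkQ, m.mkQ_surjective⟩
  · rintro ⟨S, hS⟩
    have := IsSimpleModule.nontrivial Λ S
    obtain ⟨x, hx⟩ := exists_ne (0 : S)
    obtain ⟨n, hn⟩ := ENat.ne_top_iff_exists.1 (Module.length_ne_top_iff.2 hL)
    obtain ⟨P, s, r, hi, hrs, hs⟩ := exists_indec_summand n Λ hn.symm
      (LinearMap.toSpanSingleton Λ S x) (by
        intro h
        have := LinearMap.congr_fun h 1
        simp at this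
        exact hx this)
    exact ⟨⟨P, hi, s, r, hrs⟩, _, LinearMap.surjective_of_ne_zero hs⟩
  · rintro ⟨P, hi, hs⟩ ⟨S, hS⟩ ⟨P', hi', hs'⟩ ⟨S', hS'⟩ ⟨f, hf⟩ ⟨f', hf'⟩
    obtain ⟨p1, p2, p3⟩ := hfin P hs
    obtain ⟨q1, q2, q3⟩ := hfin P' hs'
    constructor
    · rintro ⟨e⟩
      exact indec_proj_top p3 hi hS hS' f (f' ∘ₗ e.toLinearMap) hf (hf'.comp e.surjective)
    · rintro ⟨e⟩
      have := IsSimpleModule.nontrivial Λ S'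
      exact indec_proj_iso p3 q3 hi hi' (e.toLinearMap ∘ₗ f) f' (e.surjective.comp hf) hf'

end IndecSec


section GenSec
variable {Λ : Type} [Ring Λ]

/-- trace of `T` in `M` -/
def tr (T M : Type) [AddCommGroup T] [Module Λ T] [AddCommGroup M] [Module Λ M] : Submodule Λ M :=
  ⨆ f : T →ₗ[Λ] M, LinearMap.range f

variable (Λ) in
/-- `M` is generated by `T` -/
def GenP (T M : Type) [AddCommGroup T] [Module Λ T] [AddCommGroup M] [Module Λ M] : Prop :=
  tr (Λ := Λ) T M = ⊤

variable {T M N : Type} [AddCommGroup T] [Module Λ T] [AddCommGroup M] [Module Λ M]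
  [AddCommGroup N] [Module Λ N]

lemma tr_map (h : M →ₗ[Λ] N) : (tr (Λ := Λ) T M).map h ≤ tr T N := by
  unfold tr
  rw [Submodule.map_iSup]
  apply iSup_le
  intro f
  rw [← LinearMap.range_comp]
  exact le_iSup (fun g : T →ₗ[Λ] N => LinearMap.range g) (h ∘ₗ f)

lemma GenP.range_le (hM : GenP Λ T M) (h : M →ₗ[Λ] N) : LinearMap.range h ≤ tr T N := by
  rw [LinearMap.range_eq_map, ← hM]
  exact tr_map h

lemma GenP.of_surj (hM : GenP Λ T M) (h : M →ₗ[Λ] N) (hs : Function.Surjective h) :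
    GenP Λ T N := by
  unfold GenP
  rw [eq_top_iff, ← LinearMap.range_eq_top.2 hs]
  exact hM.range_le h

lemma GenP.self : GenP Λ T T := by
  unfold GenP
  rw [eq_top_iff, ← LinearMap.range_id (R := Λ)]
  exact le_iSup (fun g : T →ₗ[Λ] T => LinearMap.range g) LinearMap.id

lemma GenP.iSup {ι : Type} (Y : ι → Type) [∀ i, AddCommGroup (Y i)] [∀ i, Module Λ (Y i)]
    (hY : ∀ i, GenP Λ T (Y i)) (f : ∀ i, Y i →ₗ[Λ] M) :
    GenP Λ T ↥(⨆ i, LinearMap.range (f i)) := by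
  set S := ⨆ i, LinearMap.range (f i) with hS
  have key : S ≤ (tr T S).map S.subtype := by
    conv_lhs => rw [hS]
    apply iSup_le
    intro i
    have hle : ∀ x, f i x ∈ S := fun x => (le_iSup (fun i => LinearMap.range (f i)) i) ⟨x, rfl⟩
    have := Submodule.map_mono (f := S.subtype) ((hY i).range_le ((f i).codRestrict S hle))
    refine le_trans ?_ this
    rintro _ ⟨x, rfl⟩
    exact ⟨⟨f i x, hle x⟩, ⟨x, rfl⟩, rfl⟩
  unfold GenP
  rw [eq_top_iff]
  intro x _
  obtain ⟨y, hy, hyx⟩ := key x.2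
  have : y = x := Subtype.ext hyx
  rwa [← this]

lemma GenP.pi {ι : Type} [Finite ι] (Y : ι → Type) [∀ i, AddCommGroup (Y i)] [∀ i, Module Λ (Y i)]
    (hY : ∀ i, GenP Λ T (Y i)) : GenP Λ T (∀ i, Y i) := by
  classical
  cases nonempty_fintype ι
  unfold GenP
  rw [eq_top_iff]
  intro x _
  rw [← Finset.univ_sum_single x]
  apply Submodule.sum_mem
  intro i _
  exact (hY i).range_le (LinearMap.single Λ Y i) ⟨x i, rfl⟩

lemma Spl.lift (h : Spl Λ T M) {E Z : Type} [AddCommGroup E] [Module Λ E] [AddCommGroup Z]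
    [Module Λ Z] (i : M →ₗ[Λ] E) (q : E →ₗ[Λ] Z) (hi : Function.Injective i)
    (hq : Function.Surjective q) (hex : Function.Exact i q) (g : T →ₗ[Λ] Z) :
    ∃ u : T →ₗ[Λ] E, q ∘ₗ u = g := by
  let W : Submodule Λ (E × T) := LinearMap.ker (q ∘ₗ LinearMap.fst Λ E T - g ∘ₗ LinearMap.snd Λ E T)
  have hW : ∀ w : E × T, w ∈ W ↔ q w.1 = g w.2 := by
    intro w
    simp [W, sub_eq_zero]
  let i' : M →ₗ[Λ] W := (LinearMap.inl Λ E T ∘ₗ i).codRestrict W (by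
    intro m; rw [hW]; simp [hex.apply_apply_eq_zero])
  let q' : W →ₗ[Λ] T := LinearMap.snd Λ E T ∘ₗ W.subtype
  obtain ⟨s, hs⟩ := h W i' q' (by
      intro a b hab
      apply hi
      exact congrArg (fun w : W => w.1.1) hab) (by
      intro t
      obtain ⟨e, he⟩ := hq (g t)
      exact ⟨⟨(e, t), (hW _).2 he⟩, rfl⟩) (by
      rintro ⟨⟨e, t⟩, hw⟩
      rw [hW] at hw
      constructor
      · intro ht
        have ht' : t = 0 := ht
        subst ht'
        obtain ⟨m, hm⟩ := (hex e).1 (by simpa using hw)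
        exact ⟨m, Subtype.ext (Prod.ext hm rfl)⟩
      · rintro ⟨m, hm⟩
        exact (congrArg (fun w : W => w.1.2) hm).symm)
  refine ⟨LinearMap.fst Λ E T ∘ₗ W.subtype ∘ₗ s, ?_⟩
  ext t
  have h1 := (hW _).1 (s t).2
  have h2 : (s t).1.2 = t := LinearMap.congr_fun hs t
  rw [h2] at h1
  exact h1

lemma Spl.summand (h : Spl Λ T M) {T' : Type} [AddCommGroup T'] [Module Λ T']
    (s : T' →ₗ[Λ] T) (r : T →ₗ[Λ] T') (hrs : r ∘ₗ s = LinearMap.id) : Spl Λ T' M := by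
  intro E _ _ i q hi hq hex
  obtain ⟨u, hu⟩ := h.lift i q hi hq hex r
  exact ⟨u ∘ₗ s, by rw [← LinearMap.comp_assoc, hu, hrs]⟩

/-- restriction to the kernel -/
def resK {P T : Type} (M : Type) [AddCommGroup P] [Module Λ P]
    [AddCommGroup T] [Module Λ T] [AddCommGroup M]
    [Module Λ M] (p : P →ₗ[Λ] T) (g : P →ₗ[Λ] M) : LinearMap.ker p →ₗ[Λ] M :=
  g ∘ₗ (LinearMap.ker p).subtype

lemma resK_inj {P : Type} [AddCommGroup P] [Module Λ P] (p : P →ₗ[Λ] T)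
    (hp : Function.Surjective p) (h : ∀ g : T →ₗ[Λ] M, g = 0) : Function.Injective (resK M p) := by
  intro a b hab
  obtain ⟨g, hg⟩ := exists_factor_surj p hp (a - b) (by
    intro x hx
    have := LinearMap.congr_fun hab ⟨x, hx⟩
    simp only [resK, LinearMap.comp_apply, Submodule.subtype_apply] at this
    simp [this])
  rw [h g, LinearMap.zero_comp] at hg
  exact (sub_eq_zero.1 hg.symm)

lemma split_of_resK {U P V : Type} [AddCommGroup U] [Module Λ U] [AddCommGroup P] [Module Λ P]
    [AddCommGroup V] [Module Λ V] [Module.Projective Λ P]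
    (π : V →ₗ[Λ] U) (hπsurj : Function.Surjective π) (p : P →ₗ[Λ] U) (hp : Function.Surjective p)
    (tL : Submodule Λ (LinearMap.ker π)) (hE : ExtP tL p)
    (hsurj : Function.Surjective (resK (LinearMap.ker π ⧸ tL) p)) :
    ∃ s : U →ₗ[Λ] V, π ∘ₗ s = LinearMap.id := by
  obtain ⟨u, hu⟩ := Module.projective_lifting_property π p hπsurj
  have hu' : ∀ x, π (u x) = p x := fun x => LinearMap.congr_fun hu x
  let uK : LinearMap.ker p →ₗ[Λ] LinearMap.ker π := (u ∘ₗ (LinearMap.ker p).subtype).codRestrict (LinearMap.ker π) (by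
    intro x
    rw [LinearMap.mem_ker, LinearMap.comp_apply, hu']
    exact x.2)
  obtain ⟨h0, hh0⟩ := hsurj (tL.mkQ ∘ₗ uK)
  obtain ⟨h, hh⟩ := Module.projective_lifting_property tL.mkQ h0 tL.mkQ_surjective
  have hk0 : ∀ x, (uK - h ∘ₗ (LinearMap.ker p).subtype) x ∈ LinearMap.range tL.subtype := by
      intro x
      rw [Submodule.range_subtype, ← Submodule.Quotient.mk_eq_zero, ← Submodule.mkQ_apply,
        LinearMap.sub_apply, map_sub, sub_eq_zero]
      have h1 := LinearMap.congr_fun hh0 x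
      have h2 := LinearMap.congr_fun hh x.1
      exact (h2.trans h1).symm
  obtain ⟨k, hk⟩ := exists_factor_inj tL.subtype tL.injective_subtype
    (uK - h ∘ₗ (LinearMap.ker p).subtype) hk0
  obtain ⟨h', hh'⟩ := hE k
  obtain ⟨s, hs⟩ := exists_factor_surj p hp
    (u - (LinearMap.ker π).subtype ∘ₗ h - (LinearMap.ker π).subtype ∘ₗ tL.subtype ∘ₗ h') (by
      intro x hx
      have h1 := congrArg ((LinearMap.ker π).subtype) (LinearMap.congr_fun hk ⟨x, hx⟩)
      have h2 := LinearMap.congr_fun hh' ⟨x, hx⟩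
      simp only [LinearMap.comp_apply, Submodule.subtype_apply, LinearMap.sub_apply] at h1 h2 ⊢
      rw [h2, h1]
      simp [uK])
  have hps : π ∘ₗ s = LinearMap.id := by
    ext y
    obtain ⟨x, rfl⟩ := hp y
    have h1 := LinearMap.congr_fun hs x
    simp only [LinearMap.comp_apply] at h1
    have h2 : π (h x).1 = 0 := (h x).2
    have h3 : π (h' x).1.1 = 0 := (h' x).1.2
    rw [LinearMap.comp_apply, h1]
    simp [hu', h2, h3]
  exact ⟨s, hps⟩

theorem exists_X {m : ℕ} (U P : Fin m → Type) [∀ j, AddCommGroup (U j)] [∀ j, Module Λ (U j)]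
    [∀ j, AddCommGroup (P j)] [∀ j, Module Λ (P j)] [IsNoetherianRing Λ]
    (hfl : ∀ j, IsFiniteLength Λ (U j))
    (hind : ∀ j, isIndec Λ (U j)) (hne : ∀ i j, i ≠ j → IsEmpty (U i ≃ₗ[Λ] U j))
    (hgen : ∀ j, GenP Λ T (U j))
    (H : ∀ j (M : Type) [AddCommGroup M] [Module Λ M], GenP Λ T M → Spl Λ (U j) M)
    (p : ∀ j, P j →ₗ[Λ] U j) (hp : ∀ j, Function.Surjective (p j))
    (hP : ∀ j, Module.Projective Λ (P j)) (hK : ∀ j, Module.Projective Λ (LinearMap.ker (p j)))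
    (happ : ∀ i j, ∃ t : Finset (U j →ₗ[Λ] U i), (∀ g ∈ t, ¬ Function.Bijective g) ∧
      ∀ f : U j →ₗ[Λ] U i, ¬ Function.Bijective f → ∃ c : (U j →ₗ[Λ] U i) → (U j →ₗ[Λ] U j),
        f = ∑ g ∈ t, g ∘ₗ c g)
    (i : Fin m) : ∃ X : ModuleCat.{0} Λ, Module.Finite Λ X ∧
      (∀ j, j ≠ i → Function.Bijective (resK X (p j))) ∧
      ((Function.Surjective (resK X (p i)) ∧ ¬ Function.Injective (resK X (p i))) ∨
       (Function.Injective (resK X (p i)) ∧ ¬ Function.Surjective (resK X (p i)))) := by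
  classical
  have hfin : ∀ j, Module.Finite Λ (U j) := fun j => by
    have := (isFiniteLength_iff_isNoetherian_isArtinian.1 (hfl j)).1
    infer_instance
  have hnb : ∀ j, j ≠ i → ∀ f : U j →ₗ[Λ] U i, ¬ Function.Bijective f := by
    intro j hj f hf
    exact (hne j i hj).false (LinearEquiv.ofBijective f hf)
  let N : Submodule Λ (U i) :=
    ⨆ k : (Σ j, {f : U j →ₗ[Λ] U i // ¬ Function.Bijective f}), LinearMap.range k.2.1
  have hN : GenP Λ T N := GenP.iSup (fun k : (Σ j, {f : U j →ₗ[Λ] U i // ¬ Function.Bijective f}) =>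
    U k.1) (fun k => hgen k.1) (fun k => k.2.1)
  have hNle : ∀ j (f : U j →ₗ[Λ] U i), ¬ Function.Bijective f → LinearMap.range f ≤ N := by
    intro j f hf
    exact le_iSup (fun k : (Σ j, {f : U j →ₗ[Λ] U i // ¬ Function.Bijective f}) =>
      LinearMap.range k.2.1) ⟨j, f, hf⟩
  by_cases hNt : N = ⊤
  · choose t ht1 ht2 using happ i
    let V := ∀ k : (Σ j, {f // f ∈ t j}), U k.1
    let π : V →ₗ[Λ] U i := LinearMap.lsum Λ (fun k : (Σ j, {f // f ∈ t j}) => U k.1) ℕ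
      (fun k => k.2.1)
    have hπ : ∀ v : V, π v = ∑ k : (Σ j, {f // f ∈ t j}), k.2.1 (v k) := by
      intro v
      simp only [π, LinearMap.lsum_apply, LinearMap.sum_apply, LinearMap.comp_apply,
        LinearMap.proj_apply]
      rfl
    have hπs : ∀ (k : (Σ j, {f // f ∈ t j})) (x : U k.1),
        π (LinearMap.single Λ (fun k : (Σ j, {f // f ∈ t j}) => U k.1) k x) = k.2.1 x := by
      intro k x
      simp only [π]
      exact LinearMap.lsum_piSingle _ _ _ _ _ _
    have hlift : ∀ j (f : U j →ₗ[Λ] U i), ¬ Function.Bijective f →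
        ∃ w : U j →ₗ[Λ] V, π ∘ₗ w = f := by
      intro j f hf
      obtain ⟨c, hc⟩ := ht2 j f hf
      refine ⟨∑ g : {f // f ∈ t j}, LinearMap.single Λ (fun k : (Σ j, {f // f ∈ t j}) => U k.1)
        ⟨j, g⟩ ∘ₗ c g.1, ?_⟩
      ext x
      conv_rhs => rw [hc]
      rw [LinearMap.comp_apply, LinearMap.sum_apply, LinearMap.sum_apply, map_sum,
        ← Finset.sum_coe_sort (t j)]
      apply Finset.sum_congr rfl
      intro g _
      exact hπs ⟨j, g⟩ _
    have hπsurj : Function.Surjective π := by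
      rw [← LinearMap.range_eq_top, eq_top_iff, ← hNt]
      apply iSup_le
      rintro ⟨j, f, hf⟩
      obtain ⟨w, hw⟩ := hlift j f hf
      rintro _ ⟨x, rfl⟩
      exact ⟨w x, LinearMap.congr_fun hw x⟩
    have hV : GenP Λ T V := GenP.pi _ (fun k => hgen k.1)
    let L := LinearMap.ker π
    let tL : Submodule Λ L := ⨆ k : (Σ j, (U j →ₗ[Λ] L)), LinearMap.range k.2
    have htL : GenP Λ T tL := GenP.iSup (fun k : (Σ j, (U j →ₗ[Λ] L)) => U k.1)
      (fun k => hgen k.1) (fun k => k.2)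
    have hVf : Module.Finite Λ V := inferInstance
    have hLf : Module.Finite Λ L := inferInstance
    have hinj : ∀ j, Function.Injective (resK (L ⧸ tL) (p j)) := by
      intro j
      apply resK_inj (p j) (hp j)
      intro g
      obtain ⟨u, rfl⟩ := (H j _ htL).lift tL.subtype tL.mkQ tL.injective_subtype tL.mkQ_surjective
        (LinearMap.exact_subtype_mkQ tL) g
      ext x
      simp only [LinearMap.comp_apply, LinearMap.zero_apply, Submodule.mkQ_apply,
        Submodule.Quotient.mk_eq_zero]
      exact le_iSup (fun k : (Σ j, (U j →ₗ[Λ] L)) => LinearMap.range k.2) ⟨j, u⟩ ⟨x, rfl⟩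
    refine ⟨ModuleCat.of Λ (L ⧸ tL), inferInstanceAs (Module.Finite Λ (L ⧸ tL)), ?_, Or.inr ⟨?_, ?_⟩⟩
    · intro j hj
      refine ⟨hinj j, ?_⟩
      intro k0
      obtain ⟨k, hk⟩ := Module.projective_lifting_property tL.mkQ k0 tL.mkQ_surjective
      obtain ⟨u, hu⟩ := (H j _ hV).extP (p j) (hp j) (L.subtype ∘ₗ k)
      obtain ⟨f, hf⟩ := exists_factor_surj (p j) (hp j) (π ∘ₗ u) (by
        intro x hx
        have h1 := LinearMap.congr_fun hu ⟨x, hx⟩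
        simp only [LinearMap.comp_apply, Submodule.subtype_apply] at h1
        rw [LinearMap.comp_apply, h1]
        exact (k _).2)
      obtain ⟨w, hw⟩ := hlift j f (hnb j hj f)
      refine ⟨tL.mkQ ∘ₗ (u - w ∘ₗ p j).codRestrict L (by
        intro x
        have h1 := LinearMap.congr_fun hf x
        have h2 := LinearMap.congr_fun hw (p j x)
        simp only [LinearMap.comp_apply] at h1 h2
        simp [L, h1, h2]), ?_⟩
      rw [← hk]
      ext x
      simp only [resK, LinearMap.comp_apply]
      congr 1
      apply Subtype.ext
      have h1 := LinearMap.congr_fun hu x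
      simp only [LinearMap.comp_apply, Submodule.subtype_apply] at h1
      simp [h1]
    · exact hinj i
    · intro hsurj
      obtain ⟨s, hps⟩ := split_of_resK π hπsurj (p i) (hp i) tL ((H i _ htL).extP (p i) (hp i)) hsurj
      have hsum : (∑ k : (Σ j, {f // f ∈ t j}), k.2.1 ∘ₗ (LinearMap.proj k ∘ₗ s)) =
          (LinearMap.id : U i →ₗ[Λ] U i) := by
        rw [← hps]
        ext x
        rw [LinearMap.comp_apply, hπ, LinearMap.sum_apply]
        rfl
      refine nonbij_sum (hfl i) (hind i) Finset.univ
        (fun k : (Σ j, {f // f ∈ t j}) => k.2.1 ∘ₗ (LinearMap.proj k ∘ₗ s)) ?_ ?_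
      · intro k _ hb
        exact ht1 _ _ k.2.2 (bij_of_comp (hind i) (hind k.1) _ _ hb)
      · rw [hsum]
        exact Function.bijective_id
  · have hX : GenP Λ T (U i ⧸ N) := (hgen i).of_surj N.mkQ N.mkQ_surjective
    refine ⟨ModuleCat.of Λ (U i ⧸ N), inferInstanceAs (Module.Finite Λ (U i ⧸ N)), ?_, Or.inl ⟨?_, ?_⟩⟩
    · intro j hj
      refine ⟨?_, fun k => (H j _ hX).extP (p j) (hp j) k⟩
      apply resK_inj (p j) (hp j)
      intro g
      obtain ⟨u, rfl⟩ := (H j _ hN).lift N.subtype N.mkQ N.injective_subtype N.mkQ_surjective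
        (LinearMap.exact_subtype_mkQ N) g
      ext x
      simp only [LinearMap.comp_apply, LinearMap.zero_apply, Submodule.mkQ_apply,
        Submodule.Quotient.mk_eq_zero]
      exact hNle j u (hnb j hj u) ⟨x, rfl⟩
    · exact fun k => (H i _ hX).extP (p i) (hp i) k
    · intro hi
      have : N.mkQ ∘ₗ p i = 0 := hi (by
        ext x
        have : p i x = 0 := x.2
        simp [resK, this])
      apply hNt
      rw [eq_top_iff]
      intro x _
      obtain ⟨y, rfl⟩ := hp i x
      rw [← Submodule.Quotient.mk_eq_zero, ← Submodule.mkQ_apply]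
      exact LinearMap.congr_fun this y

end GenSec


section HL
variable (R : Type) {Λ : Type} [CommRing R] [Ring Λ] [Algebra R Λ]

variable (Λ) in
/-- the induced module structure -/
@[reducible] def rmod (M : Type) [AddCommGroup M] [Module Λ M] : Module R M :=
  Module.compHom M (algebraMap R Λ)

variable (Λ) in
lemma rtower (M : Type) [AddCommGroup M] [Module Λ M] :
    letI := rmod R Λ M
    IsScalarTower R Λ M := by
  letI := rmod R Λ M
  refine ⟨fun r a x => ?_⟩
  rw [Algebra.smul_def, mul_smul]
  rfl

/-- `R`-length of the Hom module -/
noncomputable def hl (P M : Type) [AddCommGroup P] [Module Λ P] [AddCommGroup M] [Module Λ M] : ℕ :=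
  letI := rmod R Λ M
  haveI := rtower R Λ M
  (Module.length R (P →ₗ[Λ] M)).toNat

lemma fin_over [Module.Finite R Λ] (M : Type) [AddCommGroup M] [Module Λ M] [Module R M]
    [IsScalarTower R Λ M] [Module.Finite Λ M] : Module.Finite R M := Module.Finite.trans Λ M

variable {R} in
lemma map_rsmul {M N : Type} [AddCommGroup M] [Module Λ M] [Module R M] [IsScalarTower R Λ M]
    [AddCommGroup N] [Module Λ N] [Module R N] [IsScalarTower R Λ N] (f : M →ₗ[Λ] N) (r : R) (x : M) :
    f (r • x) = r • f x := by
  rw [← algebraMap_smul Λ r x, map_smul, algebraMap_smul]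

lemma hom_fin [IsArtinianRing R] [Module.Finite R Λ] (P M : Type) [AddCommGroup P] [Module Λ P]
    [AddCommGroup M] [Module Λ M] [Module R M] [IsScalarTower R Λ M]
    [Module.Finite Λ M] [Module.Finite Λ P] : Module.Finite R (P →ₗ[Λ] M) := by
  have := fin_over R (Λ := Λ) M
  obtain ⟨n, s, hs⟩ := Module.Finite.exists_fin (R := Λ) (M := P)
  let ev : (P →ₗ[Λ] M) →ₗ[R] (Fin n → M) :=
    { toFun := fun g k => g (s k)
      map_add' := fun _ _ => rfl
      map_smul' := fun _ _ => rfl }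
  refine Module.Finite.of_injective ev ?_
  intro f g hfg
  apply LinearMap.ext_on_range hs
  intro k
  exact congrFun hfg k

lemma hom_len [IsArtinianRing R] [Module.Finite R Λ] (P M : Type) [AddCommGroup P] [Module Λ P]
    [AddCommGroup M] [Module Λ M] [Module R M] [IsScalarTower R Λ M]
    [Module.Finite Λ M] [Module.Finite Λ P] : Module.length R (P →ₗ[Λ] M) ≠ ⊤ := by
  have := hom_fin R (Λ := Λ) P M
  exact Module.length_ne_top

/-- composition as an `R`-linear map -/
def compR (P : Type) {M N : Type} [AddCommGroup P] [Module Λ P]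
    [AddCommGroup M] [Module Λ M] [Module R M] [IsScalarTower R Λ M]
    [AddCommGroup N] [Module Λ N] [Module R N] [IsScalarTower R Λ N] (f : M →ₗ[Λ] N) :
    (P →ₗ[Λ] M) →ₗ[R] (P →ₗ[Λ] N) where
  toFun g := f ∘ₗ g
  map_add' a b := LinearMap.comp_add _ _ _
  map_smul' r g := by
    ext x
    exact map_rsmul f r (g x)

lemma hl_exact [IsArtinianRing R] [Module.Finite R Λ] (P : Type) {M M' M'' : Type}
    [AddCommGroup P] [Module Λ P] [Module.Projective Λ P] [Module.Finite Λ P]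
    [AddCommGroup M] [Module Λ M] [AddCommGroup M'] [Module Λ M'] [AddCommGroup M''] [Module Λ M'']
    [Module.Finite Λ M] [Module.Finite Λ M'] [Module.Finite Λ M'']
    (i : M' →ₗ[Λ] M) (q : M →ₗ[Λ] M'') (hi : Function.Injective i) (hq : Function.Surjective q)
    (hex : Function.Exact i q) : hl R (Λ := Λ) P M = hl R (Λ := Λ) P M' + hl R (Λ := Λ) P M'' := by
  letI := rmod R Λ M
  letI := rmod R Λ M'
  letI := rmod R Λ M''
  haveI := rtower R Λ M
  haveI := rtower R Λ M'
  haveI := rtower R Λ M''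
  change (Module.length R (P →ₗ[Λ] M)).toNat = (Module.length R (P →ₗ[Λ] M')).toNat +
    (Module.length R (P →ₗ[Λ] M'')).toNat
  rw [Module.length_eq_add_of_exact (compR R P i) (compR R P q), ENat.toNat_add]
  · exact hom_len R P M'
  · exact hom_len R P M''
  · intro a b hab
    ext x
    exact hi (LinearMap.congr_fun hab x)
  · intro g
    obtain ⟨h, hh⟩ := Module.projective_lifting_property q g hq
    exact ⟨h, hh⟩
  · intro g
    constructor
    · intro hg
      obtain ⟨k, hk⟩ := exists_factor_inj i hi g (fun x => (hex _).1 (LinearMap.congr_fun hg x))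
      exact ⟨k, hk⟩
    · rintro ⟨k, rfl⟩
      ext x
      exact hex.apply_apply_eq_zero _

lemma hl_iso (P : Type) {M M' : Type}
    [AddCommGroup P] [Module Λ P]
    [AddCommGroup M] [Module Λ M] [AddCommGroup M'] [Module Λ M']
    (e : M ≃ₗ[Λ] M') : hl R (Λ := Λ) P M = hl R (Λ := Λ) P M' := by
  letI := rmod R Λ M
  letI := rmod R Λ M'
  haveI := rtower R Λ M
  haveI := rtower R Λ M'
  change (Module.length R (P →ₗ[Λ] M)).toNat = (Module.length R (P →ₗ[Λ] M')).toNat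
  congr 1
  refine LinearEquiv.length_eq (LinearEquiv.ofBijective (compR R P e.toLinearMap) ⟨?_, ?_⟩)
  · intro a b hab
    ext x
    exact e.injective (LinearMap.congr_fun hab x)
  · intro g
    refine ⟨e.symm.toLinearMap ∘ₗ g, ?_⟩
    ext x
    exact e.apply_symm_apply _

lemma hl_sub (P : Type) {M : Type} [AddCommGroup P] [Module Λ P]
    [AddCommGroup M] [Module Λ M] [Subsingleton M] : hl R (Λ := Λ) P M = 0 := by
  letI := rmod R Λ M
  haveI := rtower R Λ M
  change (Module.length R (P →ₗ[Λ] M)).toNat = 0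
  rw [Module.length_eq_zero_iff.2 ⟨fun a b => by ext x; exact Subsingleton.elim _ _⟩]
  rfl

section res
variable [IsArtinianRing R] [Module.Finite R Λ] {P T : Type} (M : Type)
    [AddCommGroup P] [Module Λ P] [Module.Finite Λ P]
    [AddCommGroup T] [Module Λ T]
    [AddCommGroup M] [Module Λ M] [Module.Finite Λ M] (p : P →ₗ[Λ] T)
    [Module.Finite Λ (LinearMap.ker p)]

/-- `resK` as `R`-linear map -/
def resR [Module R M] [IsScalarTower R Λ M] : (P →ₗ[Λ] M) →ₗ[R] (LinearMap.ker p →ₗ[Λ] M) where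
  toFun := resK M p
  map_add' _ _ := rfl
  map_smul' _ _ := rfl

lemma hl_bij (h : Function.Bijective (resK M p)) :
    hl R (Λ := Λ) P M = hl R (Λ := Λ) (LinearMap.ker p) M := by
  letI := rmod R Λ M
  haveI := rtower R Λ M
  change (Module.length R (P →ₗ[Λ] M)).toNat = (Module.length R (LinearMap.ker p →ₗ[Λ] M)).toNat
  congr 1
  exact LinearEquiv.length_eq (LinearEquiv.ofBijective (resR R M p) h)

lemma hl_ne1 (h : Function.Surjective (resK M p)) (h' : ¬ Function.Injective (resK M p)) :
    hl R (Λ := Λ) P M ≠ hl R (Λ := Λ) (LinearMap.ker p) M := by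
  letI := rmod R Λ M
  haveI := rtower R Λ M
  change (Module.length R (P →ₗ[Λ] M)).toNat ≠ (Module.length R (LinearMap.ker p →ₗ[Λ] M)).toNat
  have h0 := Module.length_eq_add_of_exact (LinearMap.ker (resR R M p)).subtype (resR R M p)
    (Submodule.injective_subtype _) h (LinearMap.exact_subtype_ker_map _)
  have h1 := hom_len R (Λ := Λ) P M
  have h2 := hom_len R (Λ := Λ) (LinearMap.ker p) M
  intro h3
  replace h3 := (ENat.coe_toNat h1).symm.trans ((congrArg Nat.cast h3).trans (ENat.coe_toNat h2))
  rw [h3] at h0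
  have h4 : Module.length R (LinearMap.ker (resR R M p)) = 0 := by
    lift Module.length R (LinearMap.ker p →ₗ[Λ] M) to ℕ using h2 with a
    have h5 : Module.length R (LinearMap.ker (resR R M p)) ≠ ⊤ := by
      intro h6
      rw [h6] at h0
      simp at h0
    lift Module.length R (LinearMap.ker (resR R M p)) to ℕ using h5 with b
    norm_cast at h0 ⊢
    omega
  rw [Module.length_eq_zero_iff] at h4
  apply h'
  exact LinearMap.ker_eq_bot.1 ((Submodule.subsingleton_iff_eq_bot).1 h4)

lemma hl_ne2 (h : Function.Injective (resK M p)) (h' : ¬ Function.Surjective (resK M p)) :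
    hl R (Λ := Λ) P M ≠ hl R (Λ := Λ) (LinearMap.ker p) M := by
  letI := rmod R Λ M
  haveI := rtower R Λ M
  change (Module.length R (P →ₗ[Λ] M)).toNat ≠ (Module.length R (LinearMap.ker p →ₗ[Λ] M)).toNat
  have h0 := Module.length_eq_add_of_exact (resR R M p) (LinearMap.range (resR R M p)).mkQ
    h (Submodule.mkQ_surjective _) (LinearMap.exact_map_mkQ_range _)
  have h1 := hom_len R (Λ := Λ) P M
  have h2 := hom_len R (Λ := Λ) (LinearMap.ker p) M
  intro h3
  replace h3 := (ENat.coe_toNat h1).symm.trans ((congrArg Nat.cast h3).trans (ENat.coe_toNat h2))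
  rw [h3] at h0
  have h4 : Module.length R ((LinearMap.ker p →ₗ[Λ] M) ⧸ LinearMap.range (resR R M p)) = 0 := by
    lift Module.length R (LinearMap.ker p →ₗ[Λ] M) to ℕ using h2 with a
    have h5 : Module.length R ((LinearMap.ker p →ₗ[Λ] M) ⧸ LinearMap.range (resR R M p)) ≠ ⊤ := by
      intro h6
      rw [h6] at h0
      simp at h0
    lift Module.length R ((LinearMap.ker p →ₗ[Λ] M) ⧸ LinearMap.range (resR R M p)) to ℕ using h5 with b
    norm_cast at h0 ⊢
    omega
  rw [Module.length_eq_zero_iff, Submodule.Quotient.subsingleton_iff] at h4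
  exact h' (LinearMap.range_eq_top.1 h4)

end res

lemma happ_fin [IsArtinianRing R] [Module.Finite R Λ] (U V : Type) [AddCommGroup U] [Module Λ U]
    [AddCommGroup V] [Module Λ V] [Module.Finite Λ U] [Module.Finite Λ V] :
    ∃ t : Finset (U →ₗ[Λ] V), (∀ g ∈ t, ¬ Function.Bijective g) ∧
      ∀ f : U →ₗ[Λ] V, ¬ Function.Bijective f → ∃ c : (U →ₗ[Λ] V) → (U →ₗ[Λ] U),
        f = ∑ g ∈ t, g ∘ₗ c g := by
  letI := rmod R Λ U
  letI := rmod R Λ V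
  haveI := rtower R Λ U
  haveI := rtower R Λ V
  have := hom_fin R (Λ := Λ) U V
  obtain ⟨t, ht1, ht2⟩ := Submodule.fg_span_iff_fg_span_finset_subset
    {f : U →ₗ[Λ] V | ¬ Function.Bijective f} |>.1
    (IsNoetherian.noetherian (Submodule.span R {f : U →ₗ[Λ] V | ¬ Function.Bijective f}))
  refine ⟨t, fun g hg => ht1 hg, ?_⟩
  intro f hf
  have h1 : f ∈ Submodule.span R (t : Set (U →ₗ[Λ] V)) := ht2 ▸ Submodule.subset_span hf
  obtain ⟨c, -, hc⟩ := Submodule.mem_span_finset.1 h1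
  refine ⟨fun g => c g • LinearMap.id, ?_⟩
  rw [← hc]
  apply Finset.sum_congr rfl
  intro g _
  ext x
  exact (map_rsmul g (c g) x).symm

end HL


section CountSec
variable {Λ : Type} [Ring Λ]

lemma exists_inj_embed (M : Type) [AddCommGroup M] [Module Λ M] :
    ∃ (J : ModuleCat.{0} Λ) (f : M →ₗ[Λ] J), Module.Injective Λ J ∧ Function.Injective f := by
  let J := CategoryTheory.Injective.under (ModuleCat.of Λ M)
  refine ⟨J, (CategoryTheory.Injective.ι (ModuleCat.of Λ M)).hom, ?_, ?_⟩
  · have : CategoryTheory.Injective (ModuleCat.of Λ J) :=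
      inferInstanceAs (CategoryTheory.Injective J)
    exact Module.injective_module_of_injective_object Λ J
  · exact (ModuleCat.mono_iff_injective (CategoryTheory.Injective.ι (ModuleCat.of Λ M))).1 inferInstance

variable {T : Type} [AddCommGroup T] [Module Λ T]

lemma ker_proj (hJ : ∀ (J : Type) [AddCommGroup J] [Module Λ J], Module.Injective Λ J → GenP Λ T J)
    {U P : Type} [AddCommGroup U] [Module Λ U] [AddCommGroup P] [Module Λ P] [Module.Projective Λ P]
    (H : ∀ (M : Type) [AddCommGroup M] [Module Λ M], GenP Λ T M → Spl Λ U M)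
    (p : P →ₗ[Λ] U) (hp : Function.Surjective p) : Module.Projective Λ (LinearMap.ker p) := by
  apply Module.Projective.of_lifting_property''
  intro q hq
  obtain ⟨J, ι, hJi, hι⟩ := exists_inj_embed (Λ := Λ) (LinearMap.ker p →₀ Λ)
  let X : Submodule Λ J := (LinearMap.ker q).map ι
  obtain ⟨ζ, hζ⟩ := exists_factor_surj q hq (X.mkQ ∘ₗ ι) (by
    intro x hx
    rw [LinearMap.comp_apply, Submodule.mkQ_apply, Submodule.Quotient.mk_eq_zero]
    exact ⟨x, hx, rfl⟩)
  have hgen : GenP Λ T (J ⧸ X) := (hJ J hJi).of_surj X.mkQ X.mkQ_surjective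
  obtain ⟨g, hg⟩ := (H _ hgen).extP p hp ζ
  obtain ⟨h, hh⟩ := Module.projective_lifting_property X.mkQ g X.mkQ_surjective
  have key : ∀ x : LinearMap.ker p, ∀ y, q y = x → h x - ι y ∈ X := by
    intro x y hy
    rw [← Submodule.Quotient.mk_eq_zero, ← Submodule.mkQ_apply, map_sub, sub_eq_zero]
    have h1 := LinearMap.congr_fun hh x.1
    have h2 := LinearMap.congr_fun hg x
    have h3 := LinearMap.congr_fun hζ y
    simp only [LinearMap.comp_apply, Submodule.subtype_apply] at h1 h2 h3
    rw [h1, h2, ← h3, hy]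
  have hr : ∀ x, (h ∘ₗ (LinearMap.ker p).subtype) x ∈ LinearMap.range ι := by
    intro x
    obtain ⟨y, hy⟩ := hq x
    obtain ⟨z, -, hz⟩ := key x y hy
    refine ⟨z + y, ?_⟩
    rw [map_add, hz]
    simp
  obtain ⟨w, hw⟩ := exists_factor_inj ι hι (h ∘ₗ (LinearMap.ker p).subtype) hr
  refine ⟨w, ?_⟩
  ext1 x
  obtain ⟨y, hy⟩ := hq x
  obtain ⟨z, hz0, hz⟩ := key x y hy
  have h1 : ι (w x) = h x := LinearMap.congr_fun hw x
  have h2 : w x = z + y := hι (by rw [map_add, hz, h1]; simp)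
  rw [LinearMap.comp_apply, h2, map_add, LinearMap.mem_ker.1 hz0, zero_add, hy]
  rfl

lemma addv_span {m : ℕ} (v : ∀ (M : Type) [AddCommGroup M] [Module Λ M], Fin m → ℚ)
    [IsNoetherianRing Λ]
    (v0 : ∀ (M : Type) [AddCommGroup M] [Module Λ M], Subsingleton M → v M = 0)
    (v1 : ∀ (M : Type) [AddCommGroup M] [Module Λ M] (N : Submodule Λ M), Module.Finite Λ M →
      v M = v N + v (M ⧸ N))
    (v2 : ∀ (M N : Type) [AddCommGroup M] [Module Λ M] [AddCommGroup N] [Module Λ N],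
      (M ≃ₗ[Λ] N) → v M = v N) :
    ∃ w : simSet Λ → Fin m → ℚ, ∀ (M : Type) [AddCommGroup M] [Module Λ M], IsFiniteLength Λ M →
      v M ∈ Submodule.span ℚ (Set.range w) := by
  choose S hS hS2 using simSet_cases (Λ := Λ)
  refine ⟨fun x => v (S x), ?_⟩
  intro M _ _ h
  induction h with
  | @of_subsingleton M _ _ h => rw [v0 M h]; exact Submodule.zero_mem _
  | @of_simple_quotient M _ _ N hs h ih =>
    have h3 : IsFiniteLength Λ M := IsFiniteLength.of_simple_quotient h
    have h4 := (isFiniteLength_iff_isNoetherian_isArtinian.1 h3).1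
    rw [v1 M N inferInstance]
    refine Submodule.add_mem _ ih ?_
    apply Submodule.subset_span
    refine ⟨simCls (M ⧸ N) hs, ?_⟩
    have h5 := hS2 (simCls (M ⧸ N) hs)
    obtain ⟨e⟩ : Nonempty ((M ⧸ N) ≃ₗ[Λ] S (simCls (M ⧸ N) hs)) := Quotient.exact h5
    exact (v2 _ _ e).symm

theorem count_le (R : Type) [CommRing R] [Algebra R Λ] [IsArtinianRing R] [Module.Finite R Λ]
    [Module.Finite Λ T] (hL : IsFiniteLength Λ Λ)
    (hJ : ∀ (J : Type) [AddCommGroup J] [Module Λ J], Module.Injective Λ J → GenP Λ T J)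
    (H : ∀ (M : Type) [AddCommGroup M] [Module Λ M], GenP Λ T M → Spl Λ T M) :
    numIndec Λ T ≤ Nat.card (simSet Λ) := by
  classical
  obtain ⟨hN, hA⟩ := isFiniteLength_iff_isNoetherian_isArtinian.1 hL
  have hNR : IsNoetherianRing Λ := hN
  have hAR : IsArtinianRing Λ := hA
  unfold numIndec
  set Q := Quotient (isoSetoid Λ (fun N => isIndec Λ ↥N ∧
    ∃ (s : ↥N →ₗ[Λ] T) (r : T →ₗ[Λ] ↥N), r.comp s = LinearMap.id)) with hQ
  by_cases hfin : Finite Q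
  swap
  · rw [not_finite_iff_infinite] at hfin
    rw [Nat.card_eq_zero_of_infinite]
    exact Nat.zero_le _
  have e : Q ≃ Fin (Nat.card Q) := Finite.equivFin Q
  set m := Nat.card Q with hm
  let U : Fin m → Type := fun j => ↥(e.symm j).out.1
  letI : ∀ j, AddCommGroup (U j) := fun j => inferInstanceAs (AddCommGroup ↥(e.symm j).out.1)
  letI : ∀ j, Module Λ (U j) := fun j => inferInstanceAs (Module Λ ↥(e.symm j).out.1)
  have hind : ∀ j, isIndec Λ (U j) := fun j => (e.symm j).out.2.1
  have hsum : ∀ j, ∃ (s : U j →ₗ[Λ] T) (r : T →ₗ[Λ] U j), r.comp s = LinearMap.id :=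
    fun j => (e.symm j).out.2.2
  choose s r hrs using hsum
  have hrsurj : ∀ j, Function.Surjective (r j) := fun j x => ⟨s j x, LinearMap.congr_fun (hrs j) x⟩
  have hUf : ∀ j, Module.Finite Λ (U j) := fun j => Module.Finite.of_surjective (r j) (hrsurj j)
  have hfl : ∀ j, IsFiniteLength Λ (U j) := fun j =>
    isFiniteLength_iff_isNoetherian_isArtinian.2 ⟨inferInstance, inferInstance⟩
  have hne : ∀ i j, i ≠ j → IsEmpty (U i ≃ₗ[Λ] U j) := by
    intro i j hij
    refine ⟨fun f => hij ?_⟩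
    apply e.symm.injective
    rw [← Quotient.out_eq (e.symm i), ← Quotient.out_eq (e.symm j)]
    exact Quotient.sound ⟨f⟩
  have hgen : ∀ j, GenP Λ T (U j) := fun j => GenP.self.of_surj (r j) (hrsurj j)
  have HU : ∀ j (M : Type) [AddCommGroup M] [Module Λ M], GenP Λ T M → Spl Λ (U j) M :=
    fun j M _ _ hM => (H M hM).summand (s j) (r j) (hrs j)
  have hpres : ∀ j, ∃ (n : ℕ) (f : (Fin n → Λ) →ₗ[Λ] U j), Function.Surjective f :=
    fun j => Module.Finite.exists_fin' Λ (U j)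
  choose n p hp using hpres
  have hK : ∀ j, Module.Projective Λ (LinearMap.ker (p j)) := fun j => ker_proj hJ (HU j) (p j) (hp j)
  have hX := exists_X U (fun j => Fin (n j) → Λ) hfl hind hne hgen HU p hp (fun j => inferInstance)
    hK (fun i j => happ_fin R (U j) (U i))
  choose X hXf hXb hXi using hX
  let v : ∀ (M : Type) [AddCommGroup M] [Module Λ M], Fin m → ℚ := fun M _ _ j =>
    (hl R (Λ := Λ) (Fin (n j) → Λ) M : ℚ) - hl R (Λ := Λ) (LinearMap.ker (p j)) M
  obtain ⟨w, hw⟩ := addv_span (Λ := Λ) v (by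
      intro M _ _ h
      funext j
      simp only [v]
      rw [hl_sub, hl_sub]
      simp) (by
      intro M _ _ N hM
      funext j
      have h1 := hl_exact R (Λ := Λ) (Fin (n j) → Λ) N.subtype N.mkQ N.injective_subtype N.mkQ_surjective
        (LinearMap.exact_subtype_mkQ N)
      have h2 := hl_exact R (Λ := Λ) (LinearMap.ker (p j)) N.subtype N.mkQ N.injective_subtype N.mkQ_surjective
        (LinearMap.exact_subtype_mkQ N)
      simp only [v, Pi.add_apply]
      rw [h1, h2]
      push_cast
      ring) (by
      intro M N _ _ _ _ f
      funext j
      simp only [v]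
      rw [hl_iso R _ f, hl_iso R _ f])
  have hvX1 : ∀ i j, j ≠ i → v (X i) j = 0 := by
    intro i j hij
    have := hXf i
    simp only [v]
    rw [hl_bij R (X i) (p j) (hXb i j hij), sub_self]
  have hvX2 : ∀ i, v (X i) i ≠ 0 := by
    intro i
    have := hXf i
    simp only [v]
    rw [sub_ne_zero]
    rcases hXi i with ⟨h1, h2⟩ | ⟨h1, h2⟩
    · exact_mod_cast hl_ne1 R (X i) (p i) h1 h2
    · exact_mod_cast hl_ne2 R (X i) (p i) h1 h2
  have htop : Submodule.span ℚ (Set.range w) = ⊤ := by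
    rw [eq_top_iff]
    intro x _
    have hx : x = ∑ i, (x i / v (X i) i) • v (X i) := by
      funext j
      rw [Finset.sum_apply, Finset.sum_eq_single j]
      · rw [Pi.smul_apply, smul_eq_mul, div_mul_cancel₀ _ (hvX2 j)]
      · intro i _ hij
        rw [Pi.smul_apply, hvX1 i j hij.symm, smul_zero]
      · simp
    rw [hx]
    apply Submodule.sum_mem
    intro i _
    apply Submodule.smul_mem
    apply hw
    have := hXf i
    exact isFiniteLength_iff_isNoetherian_isArtinian.2 ⟨inferInstance, inferInstance⟩
  have := finite_simSet hL
  have := Fintype.ofFinite (simSet Λ)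
  have h1 := finrank_range_le_card (R := ℚ) w
  rw [Set.finrank, htop, finrank_top, Module.finrank_fin_fun] at h1
  rwa [Nat.card_eq_fintype_card]

end CountSec


section Transfer
variable {A B : Type} [Ring A] [Ring B] (φ : A →+* B)

lemma push_mod (hφ : Function.Surjective φ) (M : Type) [AddCommGroup M] [Module A M]
    (hk : ∀ a, φ a = 0 → ∀ m : M, a • m = 0) :
    ∃ inst : Module B M, ∀ (a : A) (m : M), φ a • m = a • m := by
  letI : SMul B M := ⟨fun b m => Function.surjInv hφ b • m⟩
  have h : ∀ (a : A) (m : M), φ a • m = a • m := by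
    intro a m
    change Function.surjInv hφ (φ a) • m = a • m
    rw [← sub_eq_zero, ← sub_smul]
    apply hk
    rw [map_sub, Function.surjInv_eq hφ, sub_self]
  exact ⟨Function.Surjective.moduleLeft φ hφ h, h⟩

lemma pull_mod (M : Type) [AddCommGroup M] [Module B M] :
    ∃ inst : Module A M, ∀ (a : A) (m : M), φ a • m = a • m :=
  ⟨Module.compHom M φ, fun _ _ => rfl⟩

variable {φ}

/-- `B`-linear to `A`-linear -/
def toA {M N : Type} [AddCommGroup M] [AddCommGroup N] [Module A M] [Module B M] [Module A N]
    [Module B N] (hM : ∀ (a : A) (m : M), φ a • m = a • m) (hN : ∀ (a : A) (m : N), φ a • m = a • m)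
    (f : M →ₗ[B] N) : M →ₗ[A] N where
  toFun := f
  map_add' := map_add f
  map_smul' a m := by rw [← hM, map_smul, hN]; rfl

/-- `A`-linear to `B`-linear -/
def toB (hφ : Function.Surjective φ) {M N : Type} [AddCommGroup M] [AddCommGroup N] [Module A M]
    [Module B M] [Module A N]
    [Module B N] (hM : ∀ (a : A) (m : M), φ a • m = a • m) (hN : ∀ (a : A) (m : N), φ a • m = a • m)
    (f : M →ₗ[A] N) : M →ₗ[B] N where
  toFun := f
  map_add' := map_add f
  map_smul' b m := by
    obtain ⟨a, rfl⟩ := hφ b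
    rw [hM, map_smul, ← hN]; rfl

/-- the identity as a semilinear map -/
def idS {M : Type} [AddCommGroup M] [Module A M] [Module B M]
    (hM : ∀ (a : A) (m : M), φ a • m = a • m) : M →ₛₗ[φ] M where
  toFun := id
  map_add' _ _ := rfl
  map_smul' a m := (hM a m).symm

lemma iso_iff (hφ : Function.Surjective φ) {N N1 N' N1' : Type} [AddCommGroup N] [AddCommGroup N1]
    [AddCommGroup N'] [AddCommGroup N1'] [Module A N] [Module A N1] [Module B N'] [Module B N1']
    (e : N →ₛₗ[φ] N') (he : Function.Bijective e) (e1 : N1 →ₛₗ[φ] N1') (he1 : Function.Bijective e1) :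
    Nonempty (N ≃ₗ[A] N1) ↔ Nonempty (N' ≃ₗ[B] N1') := by
  let E : N ≃+ N' := AddEquiv.ofBijective e he
  let E1 : N1 ≃+ N1' := AddEquiv.ofBijective e1 he1
  have hE : ∀ (a : A) x, E (a • x) = φ a • E x := fun a x => map_smulₛₗ e a x
  have hE1 : ∀ (a : A) x, E1 (a • x) = φ a • E1 x := fun a x => map_smulₛₗ e1 a x
  constructor
  · rintro ⟨f⟩
    refine ⟨{ (E.symm.trans f.toAddEquiv).trans E1 with map_smul' := ?_ }⟩
    intro b x
    obtain ⟨a, rfl⟩ := hφ b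
    obtain ⟨y, rfl⟩ := E.surjective x
    simp [← hE, ← hE1]
  · rintro ⟨f⟩
    refine ⟨{ (E.trans f.toAddEquiv).trans E1.symm with map_smul' := ?_ }⟩
    intro a x
    apply E1.injective
    simp [hE, hE1]

lemma indec_iff (hφ : Function.Surjective φ) (N : Type) [AddCommGroup N] [Module A N] [Module B N]
    (hN : ∀ (a : A) (m : N), φ a • m = a • m) : isIndec A N ↔ isIndec B N := by
  constructor
  · rintro ⟨h1, h2⟩
    refine ⟨h1, ?_⟩
    intro X Y _ _ _ _ ⟨e⟩
    obtain ⟨_, hX⟩ := pull_mod φ X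
    obtain ⟨_, hY⟩ := pull_mod φ Y
    exact h2 X Y ⟨{ e.toAddEquiv with
      map_smul' := (toA hN (fun a m => Prod.ext (hX a m.1) (hY a m.2)) e.toLinearMap).map_smul' }⟩
  · rintro ⟨h1, h2⟩
    refine ⟨h1, ?_⟩
    intro X Y _ _ _ _ ⟨e⟩
    have hk : ∀ a, φ a = 0 → ∀ m : X × Y, a • m = 0 := by
      intro a ha m
      obtain ⟨n, rfl⟩ := e.surjective m
      rw [← map_smul, ← hN, ha, zero_smul, map_zero]
    obtain ⟨_, hX⟩ := push_mod φ hφ X (fun a ha x => congrArg Prod.fst (hk a ha (x, 0)))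
    obtain ⟨_, hY⟩ := push_mod φ hφ Y (fun a ha x => congrArg Prod.snd (hk a ha (0, x)))
    exact h2 X Y ⟨{ e.toAddEquiv with
      map_smul' := (toB hφ hN (fun a m => Prod.ext (hX a m.1) (hY a m.2)) e.toLinearMap).map_smul' }⟩

lemma numIndec_eq (hφ : Function.Surjective φ) (T : Type) [AddCommGroup T] [Module A T] [Module B T]
    (hT : ∀ (a : A) (m : T), φ a • m = a • m) : numIndec A T = numIndec B T := by
  unfold numIndec
  refine card_quot_eq _ _ (fun N N' => ∃ e : N.1 →ₛₗ[φ] N'.1, Function.Bijective e) ?_ ?_ ?_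
  · rintro ⟨N, hN, s, r, hrs⟩
    obtain ⟨_, hc⟩ := push_mod φ hφ N (by
      intro a ha m
      have h1 : r (s m) = m := LinearMap.congr_fun hrs m
      rw [← h1, ← map_smul, ← hT, ha, zero_smul, map_zero])
    refine ⟨⟨ModuleCat.of B N, (indec_iff hφ N hc).1 hN, toB hφ hc hT s, toB hφ hT hc r, ?_⟩,
      idS hc, Function.bijective_id⟩
    ext x
    exact LinearMap.congr_fun hrs x
  · rintro ⟨N, hN, s, r, hrs⟩
    obtain ⟨_, hc⟩ := pull_mod φ N
    refine ⟨⟨ModuleCat.of A N, (indec_iff hφ N hc).2 hN, toA hc hT s, toA hT hc r, ?_⟩,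
      idS hc, Function.bijective_id⟩
    ext x
    exact LinearMap.congr_fun hrs x
  · rintro N N' N1 N1' ⟨e, he⟩ ⟨e1, he1⟩
    exact iso_iff hφ e he e1 he1

lemma simSet_inj (hφ : Function.Surjective φ) :
    ∃ F : simSet B → simSet A, Function.Injective F ∧ ∀ x (S : Type) [AddCommGroup S] [Module A S]
      (hS : IsSimpleModule A S), F x = simCls S hS → ∀ a, φ a = 0 → ∀ s : S, a • s = 0 := by
  haveI : RingHomSurjective φ := ⟨hφ⟩
  obtain ⟨F, hF1, hF2⟩ := quot_inj (isoSetoid B (fun N => IsSimpleModule B ↥N))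
    (isoSetoid A (fun N => IsSimpleModule A ↥N))
    (fun N' N => ∃ e : N.1 →ₛₗ[φ] N'.1, Function.Bijective e) (by
      rintro ⟨N, hN⟩
      obtain ⟨_, hc⟩ := pull_mod φ N
      exact ⟨⟨ModuleCat.of A N, (LinearMap.isSimpleModule_iff_of_bijective (idS hc)
        Function.bijective_id).2 hN⟩, idS hc, Function.bijective_id⟩) (by
      rintro N' N N1' N1 ⟨e, he⟩ ⟨e1, he1⟩
      exact (iso_iff hφ e he e1 he1).symm)
  refine ⟨F, hF1, ?_⟩
  intro x S _ _ hS hx a ha s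
  obtain ⟨N, hN, rfl⟩ := simSet_cases x
  obtain ⟨_, hc⟩ := pull_mod φ N
  have hNA : IsSimpleModule A N := (LinearMap.isSimpleModule_iff_of_bijective (idS hc)
        Function.bijective_id).2 hN
  have h1 := hF2 ⟨N, hN⟩ ⟨ModuleCat.of A N, hNA⟩ ⟨idS hc, Function.bijective_id⟩
  have h2 : simCls (Λ := A) N hNA = simCls S hS := h1.symm.trans hx
  obtain ⟨e⟩ : Nonempty (N ≃ₗ[A] S) := Quotient.exact h2
  obtain ⟨n, rfl⟩ := e.surjective s
  rw [← map_smul, ← hc, ha, zero_smul, map_zero]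

lemma simSet_card (hφ : Function.Surjective φ)
    (hk : ∀ (S : Type) [AddCommGroup S] [Module A S], IsSimpleModule A S → ∀ a, φ a = 0 →
      ∀ s : S, a • s = 0) : Nat.card (simSet A) = Nat.card (simSet B) := by
  haveI : RingHomSurjective φ := ⟨hφ⟩
  refine card_quot_eq _ _ (fun N N' => ∃ e : N.1 →ₛₗ[φ] N'.1, Function.Bijective e) ?_ ?_ ?_
  · rintro ⟨N, hN⟩
    obtain ⟨_, hc⟩ := push_mod φ hφ N (hk N hN)
    exact ⟨⟨ModuleCat.of B N, (LinearMap.isSimpleModule_iff_of_bijective (idS hc)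
        Function.bijective_id).1 hN⟩, idS hc, Function.bijective_id⟩
  · rintro ⟨N, hN⟩
    obtain ⟨_, hc⟩ := pull_mod φ N
    exact ⟨⟨ModuleCat.of A N, (LinearMap.isSimpleModule_iff_of_bijective (idS hc)
        Function.bijective_id).2 hN⟩, idS hc, Function.bijective_id⟩
  · rintro N N' N1 N1' ⟨e, he⟩ ⟨e1, he1⟩
    exact iso_iff hφ e he e1 he1

section sp
variable {T M : Type} [AddCommGroup T] [Module A T] [Module B T] [AddCommGroup M] [Module A M]
  [Module B M] (hT : ∀ (a : A) (m : T), φ a • m = a • m) (hM : ∀ (a : A) (m : M), φ a • m = a • m)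

include hT hM in
lemma spl_B_of_A (hφ : Function.Surjective φ) (h : Spl A T M) : Spl B T M := by
  intro E _ _ i q hi hq hex
  obtain ⟨_, hE⟩ := pull_mod φ E
  obtain ⟨s, hs⟩ := h E (toA hM hE i) (toA hE hT q) hi hq hex
  refine ⟨toB hφ hT hE s, ?_⟩
  ext x
  exact LinearMap.congr_fun hs x

include hT hM in
lemma spl_A_of_B (hφ : Function.Surjective φ) (h : Spl B T M)
    (hk : ∀ (E : Type) [AddCommGroup E] [Module A E] (i : M →ₗ[A] E) (q : E →ₗ[A] T),
      Function.Injective i → Function.Surjective q → Function.Exact i q →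
      ∀ a, φ a = 0 → ∀ e : E, a • e = 0) : Spl A T M := by
  intro E _ _ i q hi hq hex
  obtain ⟨_, hE⟩ := push_mod φ hφ E (hk E i q hi hq hex)
  obtain ⟨s, hs⟩ := h E (toB hφ hM hE i) (toB hφ hE hT q) hi hq hex
  refine ⟨toA hT hE s, ?_⟩
  ext x
  exact LinearMap.congr_fun hs x

include hT hM in
lemma genP_A_of_B (h : GenP B T M) : GenP A T M := by
  unfold GenP
  rw [eq_top_iff]
  have key : ∀ x ∈ tr (Λ := B) T M, x ∈ tr (Λ := A) T M := by
    intro x hx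
    unfold tr at hx
    refine Submodule.iSup_induction _ (motive := fun x => x ∈ tr (Λ := A) T M) hx ?_ ?_ ?_
    · rintro f _ ⟨y, rfl⟩
      exact (le_iSup (fun g : T →ₗ[A] M => LinearMap.range g) (toA hT hM f)) ⟨y, rfl⟩
    · exact Submodule.zero_mem _
    · intro x y hx hy
      exact Submodule.add_mem _ hx hy
  intro x _
  apply key
  rw [h]
  trivial

end sp

lemma tens_kill {T E M : Type} [AddCommGroup T] [Module A T] [AddCommGroup E] [Module A E]
    [AddCommGroup M] [Module A M] (I : TwoSidedIdeal A)
    (hs : Subsingleton (balTensor ℤ A (↥(rIdeal A I)) T)) (i : M →ₗ[A] E) (q : E →ₗ[A] T)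
    (hq : Function.Surjective q) (hex : Function.Exact i q)
    (hM : ∀ a ∈ I, ∀ m : M, a • m = 0) : ∀ a ∈ I, ∀ e : E, a • e = 0 := by
  have hker : ∀ a ∈ I, ∀ e e' : E, q e = q e' → a • e = a • e' := by
    intro a ha e e' h
    obtain ⟨m, hm⟩ := (hex (e - e')).1 (by rw [map_sub, h, sub_self])
    rw [← sub_eq_zero, ← smul_sub, ← hm, ← map_smul, hM a ha, map_zero]
  let σ := Function.surjInv hq
  have hσ : ∀ t, q (σ t) = t := Function.surjInv_eq hq
  let f : ↥(rIdeal A I) →+ T →+ E := AddMonoidHom.mk' (fun x => AddMonoidHom.mk'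
    (fun t => (x : A) • σ t) (by
      intro t t'
      rw [← smul_add]
      apply hker _ x.2
      simp [hσ])) (by
      intro x y
      ext t
      exact add_smul _ _ _)
  have hf : ∀ (r : ℤ) (x : ↥(rIdeal A I)) (t : T), f (r • x) t = f x (r • t) := by
    intro r x t
    change (r • (x : A)) • σ t = (x : A) • σ (r • t)
    rw [smul_assoc, ← smul_comm (x : A) r (σ t)]
    apply hker _ x.2
    simp [hσ]
  let ψ := TensorProduct.liftAddHom f hf
  have hψ : ∀ z ∈ balRel ℤ A (↥(rIdeal A I)) T, ψ z = 0 := by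
    intro z hz
    unfold balRel at hz
    induction hz using Submodule.span_induction with
    | mem z hz =>
      obtain ⟨x, a, t, rfl⟩ := hz
      rw [map_sub, sub_eq_zero]
      change ((x : A) * a) • σ t = (x : A) • σ (a • t)
      rw [mul_smul]
      apply hker _ x.2
      simp [hσ]
    | zero => exact map_zero _
    | add x y _ _ hx hy => rw [map_add, hx, hy, add_zero]
    | smul r x _ hx =>
      have h1 := map_intCast_smul ψ ℤ ℤ r x
      rw [Int.cast_id] at h1
      rw [h1, hx, smul_zero]
  intro a ha e
  have h1 : ((⟨a, ha⟩ : ↥(rIdeal A I)) ⊗ₜ[ℤ] (q e)) ∈ balRel ℤ A (↥(rIdeal A I)) T := by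
    rw [← Submodule.Quotient.mk_eq_zero]
    exact hs.elim _ _
  have h2 := hψ _ h1
  have h3 : a • σ (q e) = 0 := h2
  rw [← h3]
  apply hker a ha
  rw [hσ]

end Transfer


section Fin1
variable {Λ : Type} [Ring Λ] {T : Type} [AddCommGroup T] [Module Λ T]

lemma facP.genP {M : Type} [AddCommGroup M] [Module Λ M] (h : facP Λ T M) : GenP Λ T M := by
  obtain ⟨n, f, hf⟩ := h
  exact (GenP.pi (fun _ : Fin n => T) (fun _ => GenP.self)).of_surj f hf

lemma spl_gen [IsNoetherianRing Λ] [Module.Finite Λ T]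
    (h : ∀ (M : Type) [AddCommGroup M] [Module Λ M], facP Λ T M → Spl Λ T M)
    (M : Type) [AddCommGroup M] [Module Λ M] (hM : GenP Λ T M) : Spl Λ T M := by
  classical
  obtain ⟨n, p, hp⟩ := Module.Finite.exists_fin' Λ T
  apply ExtP.spl p hp
  intro k
  have hfg : (LinearMap.range k).FG := by
    rw [LinearMap.range_eq_map]
    exact (IsNoetherian.noetherian _).map k
  obtain ⟨s, hs⟩ := CompleteLattice.IsCompactElement.exists_finset_of_le_iSup _
    ((Submodule.fg_iff_compact _).1 hfg) (fun f : T →ₗ[Λ] M => LinearMap.range f)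
    (le_top.trans_eq (Eq.symm hM))
  let g : (Fin s.card → T) →ₗ[Λ] M := ∑ j, (s.equivFin.symm j).1 ∘ₗ LinearMap.proj j
  have hg : ⨆ f ∈ s, LinearMap.range f ≤ LinearMap.range g := by
    refine iSup₂_le ?_
    rintro f hf _ ⟨x, rfl⟩
    refine ⟨Pi.single (s.equivFin ⟨f, hf⟩) x, ?_⟩
    simp only [g, LinearMap.sum_apply, LinearMap.comp_apply, LinearMap.proj_apply]
    rw [Finset.sum_eq_single (s.equivFin ⟨f, hf⟩)]
    · simp
    · intro j _ hj
      rw [Pi.single_eq_of_ne hj, map_zero]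
    · simp
  obtain ⟨g', hg'⟩ := (h (LinearMap.range g) ⟨_, g.rangeRestrict, g.surjective_rangeRestrict⟩).extP p hp
    (k.codRestrict (LinearMap.range g) (fun x => hg (hs ⟨x, rfl⟩)))
  refine ⟨(LinearMap.range g).subtype ∘ₗ g', ?_⟩
  rw [LinearMap.comp_assoc, hg']
  rfl

lemma inj_gen {n : ℕ} (f : Λ →ₗ[Λ] (Fin n → T)) (hf : Function.Injective f) (J : Type)
    [AddCommGroup J] [Module Λ J] (hJ : Module.Injective Λ J) : GenP Λ T J := by
  unfold GenP
  rw [eq_top_iff]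
  intro x _
  obtain ⟨h, hh⟩ := hJ.out f hf (LinearMap.toSpanSingleton Λ J x)
  have h1 := hh 1
  rw [LinearMap.toSpanSingleton_apply, one_smul] at h1
  exact (GenP.pi (fun _ : Fin n => T) (fun _ => GenP.self)).range_le h ⟨_, h1⟩

lemma spl_fac (hpd : pdLeOne Λ T) (hT : Spl Λ T T) (M : Type) [AddCommGroup M] [Module Λ M]
    (hM : facP Λ T M) : Spl Λ T M := by
  obtain ⟨P0, P1, hP0, hP1, i, p, hi, hp, hex⟩ := hpd
  obtain ⟨n, f, hf⟩ := hM
  apply ExtP.spl p hp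
  intro k
  let e : P1 ≃ₗ[Λ] LinearMap.ker p := LinearEquiv.ofBijective
    (i.codRestrict (LinearMap.ker p) (fun x => hex.apply_apply_eq_zero x)) ⟨fun a b hab =>
      hi (congrArg Subtype.val hab), fun ⟨x, hx⟩ => by
      obtain ⟨y, hy⟩ := (hex x).1 hx
      exact ⟨y, Subtype.ext hy⟩⟩
  have : Module.Projective Λ (LinearMap.ker p) := Module.Projective.of_equiv e
  obtain ⟨k', hk'⟩ := Module.projective_lifting_property f k hf
  have h1 := fun l => hT.extP p hp (LinearMap.proj l ∘ₗ k')
  choose g hg using h1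
  refine ⟨f ∘ₗ LinearMap.pi g, ?_⟩
  rw [← hk', LinearMap.comp_assoc]
  congr 1
  ext x l
  exact LinearMap.congr_fun (hg l) x

end Fin1

section Nil
variable {A : Type} [Ring A] (I : TwoSidedIdeal A)

lemma simple_killed {n : ℕ} (hn : idealPow A I.asIdeal (n + 1) = ⊥) (S : Type) [AddCommGroup S]
    [Module A S] (hS : IsSimpleModule A S) (a : A) (ha : a ∈ I) (s : S) : a • s = 0 := by
  let W : Submodule A S :=
    { carrier := {s | ∀ a ∈ I, a • s = 0}
      add_mem' := fun {x y} hx hy a ha => by rw [smul_add, hx a ha, hy a ha, add_zero]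
      zero_mem' := fun a _ => smul_zero a
      smul_mem' := fun c x hx a ha => by
        rw [← mul_smul]
        exact hx _ (I.mul_mem_right a c ha) }
  rcases eq_bot_or_eq_top W with hW | hW
  · exfalso
    have h1 : ∀ s : S, s ≠ 0 → ∃ a ∈ I, a • s ≠ 0 := by
      intro s hs
      by_contra hcon
      push Not at hcon
      apply hs
      rw [← Submodule.mem_bot A, ← hW]
      exact hcon
    have h2 : ∀ n, ∀ s : S, s ≠ 0 → ∃ b ∈ idealPow A I.asIdeal n, b • s ≠ 0 := by
      intro n
      induction n with
      | zero => intro s hs; exact ⟨1, trivial, by rwa [one_smul]⟩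
      | succ n ih =>
        intro s hs
        obtain ⟨b, hb, hbs⟩ := ih s hs
        obtain ⟨a, ha, has⟩ := h1 _ hbs
        refine ⟨a * b, Submodule.subset_span ⟨a, ha, b, hb, rfl⟩, ?_⟩
        rwa [mul_smul]
    have := IsSimpleModule.nontrivial A S
    obtain ⟨s, hs⟩ := exists_ne (0 : S)
    obtain ⟨b, hb, hbs⟩ := h2 (n + 1) s hs
    rw [hn, Submodule.mem_bot] at hb
    rw [hb, zero_smul] at hbs
    exact hbs rfl
  · have : s ∈ W := by rw [hW]; trivial
    exact this a ha

lemma nilp_of_killed [IsArtinianRing A] [IsNoetherianRing A]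
    (h : ∀ (S : Type) [AddCommGroup S] [Module A S], IsSimpleModule A S → ∀ a ∈ I, ∀ s : S, a • s = 0) :
    ∃ n : ℕ, idealPow A I.asIdeal (n + 1) = ⊥ := by
  have hanti : Antitone (idealPow A I.asIdeal) := by
    apply antitone_nat_of_succ_le
    intro n
    refine Submodule.span_le.2 ?_
    rintro _ ⟨a, -, b, hb, rfl⟩
    exact Ideal.mul_mem_left _ a hb
  obtain ⟨n, hn⟩ := IsArtinian.monotone_stabilizes
    (⟨fun n => OrderDual.toDual (idealPow A I.asIdeal n), fun a b hab => hanti hab⟩ :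
      ℕ →o (Submodule A A)ᵒᵈ)
  have h1 : idealPow A I.asIdeal n = idealPow A I.asIdeal (n + 1) := hn (n + 1) (Nat.le_succ n)
  refine ⟨n, ?_⟩
  rw [← h1]
  set L := idealPow A I.asIdeal n with hL
  by_contra hne
  rcases eq_top_or_exists_le_coatom (⊥ : Submodule A L) with h2 | ⟨N, hN, -⟩
  · apply hne
    have : Subsingleton L := by
      rw [← Submodule.subsingleton_iff A, ← subsingleton_iff_bot_eq_top]
      exact h2
    exact (Submodule.subsingleton_iff_eq_bot).1 this
  · have hs : IsSimpleModule A (L ⧸ N) := isSimpleModule_iff_isCoatom.2 hN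
    apply hN.1
    have h3 : L ≤ N.map L.subtype := by
      conv_lhs => rw [h1]
      refine Submodule.span_le.2 ?_
      rintro _ ⟨a, ha, b, hb, rfl⟩
      have h4 := h (L ⧸ N) hs a ha (N.mkQ ⟨b, hb⟩)
      rw [← map_smul, Submodule.mkQ_apply, Submodule.Quotient.mk_eq_zero] at h4
      exact ⟨_, h4, rfl⟩
    rw [eq_top_iff]
    intro x _
    obtain ⟨y, hy, hyx⟩ := h3 x.2
    have : y = x := Subtype.ext hyx
    rwa [← this]

end Nil

section Tens
variable {A : Type} [Ring A] (I : TwoSidedIdeal A) {T : Type} [AddCommGroup T] [Module A T]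

/-- class of a pure tensor -/
def bt (i : ↥(rIdeal A I)) (t : T) : balTensor ℤ A (↥(rIdeal A I)) T :=
  (balRel ℤ A (↥(rIdeal A I)) T).mkQ (i ⊗ₜ[ℤ] t)

lemma bt_add_left (i j : ↥(rIdeal A I)) (t : T) : bt I (i + j) t = bt I i t + bt I j t := by
  unfold bt
  rw [TensorProduct.add_tmul]
  exact map_add _ _ _

lemma bt_add_right (i : ↥(rIdeal A I)) (t t' : T) : bt I i (t + t') = bt I i t + bt I i t' := by
  unfold bt
  rw [TensorProduct.tmul_add]
  exact map_add _ _ _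

lemma bt_zero_right (i : ↥(rIdeal A I)) : bt I i (0 : T) = 0 := by
  unfold bt
  rw [TensorProduct.tmul_zero]
  exact map_zero _

lemma bt_zero_left (t : T) : bt I (0 : ↥(rIdeal A I)) t = 0 := by
  unfold bt
  rw [TensorProduct.zero_tmul]
  exact map_zero _

lemma bt_sum_right {n : ℕ} (i : ↥(rIdeal A I)) (t : Fin n → T) :
    bt I i (∑ l, t l) = ∑ l, bt I i (t l) :=
  map_sum (AddMonoidHom.mk' (bt I i) (bt_add_right I i)) t Finset.univ

lemma bt_smul (i : ↥(rIdeal A I)) (a : A) (t : T) :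
    bt I i (a • t) = bt I ⟨(i : A) * a, I.mul_mem_right _ _ i.2⟩ t := by
  unfold bt
  symm
  have h : ((⟨(i : A) * a, I.mul_mem_right _ _ i.2⟩ : ↥(rIdeal A I)) ⊗ₜ[ℤ] t - i ⊗ₜ[ℤ] (a • t)) ∈
      balRel ℤ A (↥(rIdeal A I)) T := Submodule.subset_span ⟨i, a, t, rfl⟩
  exact (Submodule.Quotient.eq _).2 h

lemma tens_zero {n : ℕ} (p : (Fin n → A) →ₗ[A] T) (hp : Function.Surjective p)
    (W : Submodule A (LinearMap.ker p))
    (hW : W ≤ Submodule.span A {y | ∃ j ∈ I, ∃ k : LinearMap.ker p, y = j • k})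
    (hIP : ∀ j ∈ I, ∀ x : Fin n → A, ∃ y ∈ W, (y : Fin n → A) = j • x) :
    Subsingleton (balTensor ℤ A (↥(rIdeal A I)) T) := by
  classical
  let t : Fin n → T := fun l => p fun j => if l = j then 1 else 0
  have hpt : ∀ x, p x = ∑ l, x l • t l := fun x => LinearMap.pi_apply_eq_sum_univ p x
  have key1 : ∀ (i : ↥(rIdeal A I)) (x : Fin n → A),
      bt I i (p x) = ∑ l, bt I ⟨(i : A) * x l, I.mul_mem_right _ _ i.2⟩ (t l) := by
    intro i x
    rw [hpt, bt_sum_right]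
    exact Finset.sum_congr rfl (fun l _ => bt_smul I i (x l) (t l))
  have key2 : ∀ y ∈ W, ∀ a : A, ∃ y' : Fin n → ↥(rIdeal A I),
      (∀ l, (y' l : A) = a * (y : Fin n → A) l) ∧ ∑ l, bt I (y' l) (t l) = 0 := by
    intro y hy
    replace hy := hW hy
    induction hy using Submodule.span_induction with
    | mem y hy =>
      obtain ⟨j, hj, k, rfl⟩ := hy
      intro a
      refine ⟨fun l => ⟨(a * j) * k.1 l, I.mul_mem_right _ _ (I.mul_mem_left _ _ hj)⟩, ?_, ?_⟩
      · intro l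
        exact mul_assoc _ _ _
      · rw [← key1 ⟨a * j, I.mul_mem_left _ _ hj⟩ k.1, LinearMap.mem_ker.1 k.2, bt_zero_right]
    | zero =>
      intro a
      refine ⟨fun _ => 0, ?_, ?_⟩
      · intro l
        simp
      · simp [bt_zero_left]
    | add x y _ _ hx hy =>
      intro a
      obtain ⟨x', hx1, hx2⟩ := hx a
      obtain ⟨y', hy1, hy2⟩ := hy a
      refine ⟨fun l => x' l + y' l, ?_, ?_⟩
      · intro l
        simp [hx1, hy1, mul_add]
      · simp only [bt_add_left]
        rw [Finset.sum_add_distrib, hx2, hy2, add_zero]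
    | smul c x _ hx =>
      intro a
      obtain ⟨x', hx1, hx2⟩ := hx (a * c)
      refine ⟨x', ?_, hx2⟩
      intro l
      rw [hx1]
      exact mul_assoc _ _ _
  have key3 : ∀ (i : ↥(rIdeal A I)) (s : T), bt I i s = 0 := by
    intro i s
    obtain ⟨x, rfl⟩ := hp s
    obtain ⟨y, hy, hyx⟩ := hIP i i.2 x
    obtain ⟨y', h1, h2⟩ := key2 y hy 1
    rw [key1, ← h2]
    apply Finset.sum_congr rfl
    intro l _
    congr 1
    apply Subtype.ext
    rw [h1, one_mul, hyx]
    rfl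
  have key4 : ∀ z : (↥(rIdeal A I)) ⊗[ℤ] T, (balRel ℤ A (↥(rIdeal A I)) T).mkQ z = 0 := by
    intro z
    induction z using TensorProduct.induction_on with
    | zero => exact map_zero _
    | tmul i s => exact key3 i s
    | add x y hx hy => rw [map_add, hx, hy, add_zero]
  refine ⟨fun a b => ?_⟩
  obtain ⟨x, rfl⟩ := Submodule.mkQ_surjective _ a
  obtain ⟨y, rfl⟩ := Submodule.mkQ_surjective _ b
  exact (key4 x).trans (key4 y).symm

end Tens


lemma faith_embed (R : Type) {A B T : Type} [CommRing R] [Ring A] [Algebra R A] [Module.Finite R A]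
    [AddCommGroup T] [Module A T] [Module.Finite A T] [Ring B] (φ : A →+* B)
    (hφ : Function.Surjective φ) [Module B T] (hcomp : ∀ (a : A) (t : T), φ a • t = a • t)
    (hf : ∀ a : A, (∀ t : T, a • t = 0) → φ a = 0) :
    ∃ (n : ℕ) (f : B →ₗ[B] (Fin n → T)), Function.Injective f := by
  letI := rmod R A T
  haveI := rtower R A T
  haveI := fin_over R (Λ := A) T
  obtain ⟨n, s, hs⟩ := Module.Finite.exists_fin (R := R) (M := T)
  refine ⟨n, LinearMap.pi (fun l => LinearMap.toSpanSingleton B T (s l)), ?_⟩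
  rw [← LinearMap.ker_eq_bot, eq_bot_iff]
  intro b hb
  obtain ⟨a, rfl⟩ := hφ b
  rw [Submodule.mem_bot]
  apply hf
  intro t
  have h1 : ∀ l, a • s l = 0 := by
    intro l
    have := congrFun (LinearMap.mem_ker.1 hb) l
    rw [← hcomp]
    exact this
  have ht : t ∈ Submodule.span R (Set.range s) := by rw [hs]; trivial
  induction ht using Submodule.span_induction with
  | mem x hx => obtain ⟨l, rfl⟩ := hx; exact h1 l
  | zero => exact smul_zero a
  | add x y _ _ hx hy => rw [smul_add, hx, hy, add_zero]
  | smul r x _ hx => rw [smul_comm, hx, smul_zero]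

/-- Let `T` be a finitely generated module over an artin algebra `A`,
`I = Ann(T)` and `Ā = A/I` (presented by a surjective ring homomorphism `φ : A → B` with
kernel `I`).  Then `T` is a `τ`-tilting `A`-module if and only if `I` is nilpotent, the
`Ā`-module `T` is `1`-tilting, and `I ⊗[A] T = 0`. -/
theorem tauTilting_iff_tilting_over_quotient
    (R A : Type) [CommRing R] [IsArtinianRing R] [Ring A] [Algebra R A] [Module.Finite R A]
    (T : Type) [AddCommGroup T] [Module A T] [Module.Finite A T]
    (I : TwoSidedIdeal A) (hI : ∀ a : A, a ∈ I ↔ ∀ t : T, a • t = 0)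
    (B : Type) [Ring B] (φ : A →+* B) (hsurj : Function.Surjective φ)
    (hker : ∀ a : A, φ a = 0 ↔ a ∈ I)
    [Module B T] (hcomp : ∀ (a : A) (t : T), φ a • t = a • t) :
    (tauRigid A T ∧ numIndec A T = numIndec A A) ↔
      ((∃ n : ℕ, idealPow A I.asIdeal (n + 1) = ⊥) ∧
        (pdLeOne B T ∧ Subsingleton (egrp B 1 T T) ∧ numIndec B T = numIndec B B) ∧
        Subsingleton (balTensor ℤ A (↥(rIdeal A I)) T)) := by
  letI algB : Algebra R B := RingHom.toAlgebra' (φ.comp (algebraMap R A)) (by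
    intro c x
    obtain ⟨a, rfl⟩ := hsurj x
    simp only [RingHom.comp_apply]
    rw [← map_mul, ← map_mul, Algebra.commutes])
  let φR : A →ₗ[R] B :=
    { toFun := φ
      map_add' := map_add φ
      map_smul' := fun r a => by
        rw [Algebra.smul_def, map_mul]
        rfl }
  haveI finB : Module.Finite R B := Module.Finite.of_surjective φR hsurj
  haveI : IsArtinianRing A := IsArtinianRing.of_finite R A
  haveI : IsNoetherianRing A := IsNoetherianRing.of_finite R A
  haveI : IsArtinianRing B := IsArtinianRing.of_finite R B
  haveI : IsNoetherianRing B := IsNoetherianRing.of_finite R B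
  have hLA : IsFiniteLength A A :=
    isFiniteLength_iff_isNoetherian_isArtinian.2 ⟨inferInstance, inferInstance⟩
  have hLB : IsFiniteLength B B :=
    isFiniteLength_iff_isNoetherian_isArtinian.2 ⟨inferInstance, inferInstance⟩
  have hTB : Module.Finite B T := by
    classical
    obtain ⟨n, p, hp⟩ := Module.Finite.exists_fin (R := A) (M := T)
    refine ⟨⟨Finset.univ.image p, ?_⟩⟩
    rw [eq_top_iff]
    intro x _
    have hx : x ∈ Submodule.span A (Set.range p) := by rw [hp]; trivial
    rw [Finset.coe_image, Finset.coe_univ, Set.image_univ]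
    induction hx using Submodule.span_induction with
    | mem x hx => exact Submodule.subset_span hx
    | zero => exact Submodule.zero_mem _
    | add x y _ _ hx hy => exact Submodule.add_mem _ (hx trivial) (hy trivial)
    | smul r x _ hx =>
      rw [← hcomp]
      exact Submodule.smul_mem _ _ (hx trivial)
  have hnum : numIndec A T = numIndec B T := numIndec_eq hsurj T hcomp
  have hfinA := finite_simSet hLA
  have hfinB := finite_simSet hLB
  rw [hnum, numIndec_self hLA, numIndec_self hLB, egrp_iff]
  constructor
  · rintro ⟨hrig, hcard⟩
    have hfac : ∀ (M : Type) [AddCommGroup M] [Module A M], facP A T M → Spl A T M :=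
      fun M _ _ hM => (egrp_iff T M).1 (hrig M hM)
    have hgenA : ∀ (M : Type) [AddCommGroup M] [Module A M], GenP A T M → Spl A T M :=
      fun M _ _ hM => spl_gen hfac M hM
    have hgenB : ∀ (M : Type) [AddCommGroup M] [Module B M], GenP B T M → Spl B T M := by
      intro M _ _ hM
      obtain ⟨_, hc⟩ := pull_mod φ M
      exact spl_B_of_A hcomp hc hsurj (hgenA M (genP_A_of_B hcomp hc hM))
    obtain ⟨N, ff, hff⟩ := faith_embed R φ hsurj hcomp
      (fun a ha => (hker a).2 ((hI a).2 ha))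
    have hJ : ∀ (J : Type) [AddCommGroup J] [Module B J], Module.Injective B J → GenP B T J :=
      fun J _ _ hJ => inj_gen ff hff J hJ
    have hle : numIndec B T ≤ Nat.card (simSet B) := count_le R hLB hJ hgenB
    obtain ⟨F, hF1, hF2⟩ := simSet_inj hsurj
    have hle2 : Nat.card (simSet B) ≤ Nat.card (simSet A) := Nat.card_le_card_of_injective F hF1
    have hbij : Function.Bijective F := hF1.bijective_of_nat_card_le (by omega)
    refine ⟨?_, ⟨?_, hgenB T GenP.self, by omega⟩, ?_⟩
    · apply nilp_of_killed
      intro S _ _ hS a ha s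
      obtain ⟨x, hx⟩ := hbij.2 (simCls S hS)
      exact hF2 x S hS hx a ((hker a).2 ha) s
    · obtain ⟨n, p, hp⟩ := Module.Finite.exists_fin' B T
      have hK : Module.Projective B (LinearMap.ker p) := ker_proj hJ hgenB p hp
      exact ⟨ModuleCat.of B (Fin n → B), ModuleCat.of B (LinearMap.ker p),
        inferInstanceAs (Module.Projective B (Fin n → B)), hK, (LinearMap.ker p).subtype, p,
        Submodule.injective_subtype _, hp, LinearMap.exact_subtype_ker_map p⟩
    · obtain ⟨n, p, hp⟩ := Module.Finite.exists_fin' A T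
      let W : Submodule A (LinearMap.ker p) :=
        Submodule.span A {y | ∃ j ∈ I, ∃ k : LinearMap.ker p, y = j • k}
      refine tens_zero I p hp W le_rfl ?_
      intro j hj x
      have hmem : j • x ∈ LinearMap.ker p := by
        rw [LinearMap.mem_ker, map_smul]
        exact (hI j).1 hj _
      refine ⟨⟨j • x, hmem⟩, ?_, rfl⟩
      obtain ⟨_, hQ⟩ := push_mod φ hsurj (LinearMap.ker p ⧸ W) (by
        intro a ha m
        obtain ⟨k, rfl⟩ := W.mkQ_surjective m
        rw [← map_smul, Submodule.mkQ_apply, Submodule.Quotient.mk_eq_zero]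
        exact Submodule.subset_span ⟨a, (hker a).1 ha, k, rfl⟩)
      obtain ⟨J, ι, hJi, hι⟩ := exists_inj_embed (Λ := B) (LinearMap.ker p ⧸ W)
      obtain ⟨_, hJc⟩ := pull_mod φ J
      have hJA : Spl A T J := hgenA J (genP_A_of_B hcomp hJc (hJ J hJi))
      obtain ⟨g, hg⟩ := hJA.extP p hp (toA hQ hJc ι ∘ₗ W.mkQ)
      have h1 : ι (W.mkQ ⟨j • x, hmem⟩) = g (j • x) := (LinearMap.congr_fun hg ⟨j • x, hmem⟩).symm
      rw [map_smul, ← hJc, (hker j).2 hj, zero_smul] at h1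
      rw [← Submodule.Quotient.mk_eq_zero, ← Submodule.mkQ_apply]
      apply hι
      rw [h1, map_zero]
  · rintro ⟨⟨n, hn⟩, ⟨hpd, hTT, hcard⟩, htens⟩
    constructor
    · intro M _ _ hM
      rw [egrp_iff]
      have hkill : ∀ a ∈ I, ∀ m : M, a • m = 0 := by
        obtain ⟨k, f, hf⟩ := hM
        intro a ha m
        obtain ⟨y, rfl⟩ := hf m
        rw [← map_smul]
        have : a • y = 0 := funext fun l => (hI a).1 ha (y l)
        rw [this, map_zero]
      obtain ⟨_, hc⟩ := push_mod φ hsurj M (fun a ha => hkill a ((hker a).1 ha))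
      have hMB : facP B T M := by
        obtain ⟨k, f, hf⟩ := hM
        exact ⟨k, toB hsurj (fun a y => funext fun l => hcomp a (y l)) hc f, hf⟩
      refine spl_A_of_B hcomp hc hsurj (spl_fac hpd hTT M hMB) ?_
      intro E _ _ i q _ hq hex a ha e
      exact tens_kill I htens i q hq hex hkill a ((hker a).1 ha) e
    · rw [hcard, simSet_card hsurj]
      intro S _ _ hS a ha s
      exact simple_killed I hn S hS a ((hker a).1 ha) s
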